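/- arXiv:1006.3867 — 3 statements merged into one kernel-verified Lean document; each statement's English description precedes it below -/
import Mathlib

section
/- The function d defined on the tree T by d(t,s) = max_{t ≺ v ⪯ s} (Σ_{t ≺ r ⪯ v} α(r)^q)^{1/q} σ(v) for t ⪯ s, d(s,t) = d(t,s), d(t,t) = 0, and d(t,s) = d(t∧s,t) + d(t∧s,s) for incomparable t,s, is a metric on T. Moreover it has the monotonicity property: whenever t' ⪯ t ⪯ s ⪯ s', one has d(t,s) ≤ d(t',s'). -/
open scoped ENNReal NNReal

noncomputable section

/-- A rooted tree structure on a partially ordered type with bottom element (the root):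
the set of ancestors of any node is finite and totally ordered, and every node has
finitely many offspring (covering elements). -/
def IsTree (T : Type) [PartialOrder T] [OrderBot T] : Prop :=
  (∀ s : T, (Set.Iic s).Finite) ∧
  (∀ s a b : T, a ≤ s → b ≤ s → a ≤ b ∨ b ≤ a) ∧
  (∀ t : T, {s : T | t ⋖ s}.Finite)

/-- `glb` assigns to any two nodes their greatest common ancestor. -/
def IsGCA {T : Type} [PartialOrder T] (glb : T → T → T) : Prop :=
  ∀ t s : T, glb t s ≤ t ∧ glb t s ≤ s ∧ ∀ u : T, u ≤ t → u ≤ s → u ≤ glb t s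

/-- The distance `max_{t ≺ v ⪯ s} (∑_{t ≺ r ⪯ v} α(r)^q)^{1/q} σ(v)` along a branch. -/
def dOrd {T : Type} [PartialOrder T] (q : ℝ) (α σ : T → ℝ) (t s : T) : ℝ :=
  sSup ((fun v => (∑ᶠ r ∈ Set.Ioc t v, α r ^ q) ^ (1 / q) * σ v) '' Set.Ioc t s)

/- The tree metric `d`. -/
open Classical in
def treeDist {T : Type} [PartialOrder T] (q : ℝ) (α σ : T → ℝ)
    (glb : T → T → T) (t s : T) : ℝ :=
  if t ≤ s then dOrd q α σ t s
  else if s ≤ t then dOrd q α σ s t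
  else dOrd q α σ (glb t s) t + dOrd q α σ (glb t s) s

theorem finsum_rpow_nonneg {T : Type} {q : ℝ} {α : T → ℝ} (hα : ∀ t, 0 < α t) (A : Set T) :
    0 ≤ ∑ᶠ r ∈ A, α r ^ q :=
  finsum_nonneg fun r => finsum_nonneg fun _ => (Real.rpow_pos_of_pos (hα r) q).le

theorem finsum_rpow_mono {T : Type} {q : ℝ} {α : T → ℝ} (hα : ∀ t, 0 < α t) {A B : Set T}
    (hB : B.Finite) (hAB : A ⊆ B) :
    ∑ᶠ r ∈ A, α r ^ q ≤ ∑ᶠ r ∈ B, α r ^ q := by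
  rw [← Set.union_sdiff_cancel hAB,
    finsum_mem_union Set.disjoint_sdiff_right (hB.subset hAB) hB.sdiff]
  exact le_add_of_nonneg_right (finsum_rpow_nonneg hα _)

section BranchDistance

variable {T : Type} [PartialOrder T] {q : ℝ} {α σ : T → ℝ}

theorem le_dOrd (hfin : ∀ s : T, (Set.Iic s).Finite) {t v s : T} (hv : v ∈ Set.Ioc t s) :
    (∑ᶠ r ∈ Set.Ioc t v, α r ^ q) ^ (1 / q) * σ v ≤ dOrd q α σ t s :=
  le_csSup (((hfin s).subset fun _ hx => hx.2).image _).bddAbove ⟨v, hv, rfl⟩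

theorem dOrd_le {t s : T} {c : ℝ} (hc : 0 ≤ c)
    (h : ∀ v ∈ Set.Ioc t s, (∑ᶠ r ∈ Set.Ioc t v, α r ^ q) ^ (1 / q) * σ v ≤ c) :
    dOrd q α σ t s ≤ c := by
  refine Real.sSup_le ?_ hc
  rintro _ ⟨v, hv, rfl⟩
  exact h v hv

theorem dOrd_nonneg (hα : ∀ t, 0 < α t) (hσ : ∀ t, 0 < σ t) (t s : T) :
    0 ≤ dOrd q α σ t s := by
  refine Real.sSup_nonneg ?_
  rintro _ ⟨v, -, rfl⟩
  exact mul_nonneg (Real.rpow_nonneg (finsum_rpow_nonneg hα _) _) (hσ v).le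

theorem dOrd_self (t : T) : dOrd q α σ t t = 0 := by
  simp [dOrd]

theorem dOrd_pos (hfin : ∀ s : T, (Set.Iic s).Finite) (hα : ∀ t, 0 < α t)
    (hσ : ∀ t, 0 < σ t) {t s : T} (hts : t < s) : 0 < dOrd q α σ t s := by
  refine (mul_pos (Real.rpow_pos_of_pos ?_ _) (hσ s)).trans_le
    (le_dOrd hfin (Set.right_mem_Ioc.2 hts))
  calc 0 < α s ^ q := Real.rpow_pos_of_pos (hα s) q
    _ = ∑ᶠ r ∈ ({s} : Set T), α r ^ q := by rw [finsum_mem_singleton]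
    _ ≤ ∑ᶠ r ∈ Set.Ioc t s, α r ^ q := finsum_rpow_mono hα
      ((hfin s).subset Set.Ioc_subset_Iic_self)
      (Set.singleton_subset_iff.2 ⟨hts, le_rfl⟩)

theorem dOrd_mono (hfin : ∀ s : T, (Set.Iic s).Finite) (hq : 0 < q) (hα : ∀ t, 0 < α t)
    (hσ : ∀ t, 0 < σ t) {t' t s s' : T} (ht : t' ≤ t) (hs : s ≤ s') :
    dOrd q α σ t s ≤ dOrd q α σ t' s' := by
  refine dOrd_le (dOrd_nonneg hα hσ _ _) fun v hv => ?_
  refine le_trans ?_ (le_dOrd hfin (v := v) ⟨ht.trans_lt hv.1, hv.2.trans hs⟩)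
  refine mul_le_mul_of_nonneg_right ?_ (hσ v).le
  exact Real.rpow_le_rpow (finsum_rpow_nonneg hα _) (finsum_rpow_mono hα
    ((hfin v).subset Set.Ioc_subset_Iic_self) (Set.Ioc_subset_Ioc_left ht)) (by positivity)

theorem finsum_Ioc_eq_add (hfin : ∀ s : T, (Set.Iic s).Finite)
    (hchain : ∀ s a b : T, a ≤ s → b ≤ s → a ≤ b ∨ b ≤ a) (f : T → ℝ) {t r v : T}
    (htr : t ≤ r) (hrv : r ≤ v) :
    ∑ᶠ x ∈ Set.Ioc t v, f x = ∑ᶠ x ∈ Set.Ioc t r, f x + ∑ᶠ x ∈ Set.Ioc r v, f x := by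
  rw [← finsum_mem_union (Set.disjoint_left.2 fun x hx hx' => hx'.1.not_ge hx.2)
    ((hfin r).subset fun _ hx => hx.2) ((hfin v).subset fun _ hx => hx.2)]
  congr! 3 with x
  constructor
  · rintro ⟨hx, hxv⟩
    by_cases hxr : x ≤ r
    · exact Or.inl ⟨hx, hxr⟩
    · exact Or.inr ⟨lt_of_le_not_ge ((hchain v x r hxv hrv).resolve_left hxr) hxr, hxv⟩
  · rintro (⟨hx, hxr⟩ | ⟨hx, hxv⟩)
    · exact ⟨hx, hxr.trans hrv⟩
    · exact ⟨htr.trans_lt hx, hxv⟩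

theorem dOrd_triangle (hfin : ∀ s : T, (Set.Iic s).Finite)
    (hchain : ∀ s a b : T, a ≤ s → b ≤ s → a ≤ b ∨ b ≤ a) (hq : 1 ≤ q)
    (hα : ∀ t, 0 < α t) (hσ : ∀ t, 0 < σ t) (hσmono : ∀ ⦃t s : T⦄, t ≤ s → σ s ≤ σ t)
    {t r s : T} (htr : t ≤ r) (hrs : r ≤ s) :
    dOrd q α σ t s ≤ dOrd q α σ t r + dOrd q α σ r s := by
  have hq0 : 0 < q := by linarith
  have htr0 := dOrd_nonneg (q := q) hα hσ t r
  have hrs0 := dOrd_nonneg (q := q) hα hσ r s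
  refine dOrd_le (add_nonneg htr0 hrs0) fun v hv => ?_
  by_cases hvr : v ≤ r
  · exact (le_dOrd hfin (v := v) ⟨hv.1, hvr⟩).trans (le_add_of_nonneg_right hrs0)
  have hrv : r ≤ v := (hchain s v r hv.2 hrs).resolve_left hvr
  rw [finsum_Ioc_eq_add hfin hchain _ htr hrv]
  refine (mul_le_mul_of_nonneg_right (Real.rpow_add_le_add_rpow (finsum_rpow_nonneg hα _)
    (finsum_rpow_nonneg hα _) (by positivity) ((div_le_one hq0).2 hq)) (hσ v).le).trans ?_
  rw [add_mul]
  refine add_le_add ?_ (le_dOrd hfin ⟨lt_of_le_not_ge hrv hvr, hv.2⟩)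
  rcases htr.eq_or_lt with rfl | hlt
  · simp [dOrd_self, hq0.ne']
  · exact (mul_le_mul_of_nonneg_left (hσmono hrv)
      (Real.rpow_nonneg (finsum_rpow_nonneg hα _) _)).trans (le_dOrd hfin ⟨hlt, le_rfl⟩)

end BranchDistance

theorem IsGCA.eq_left {T : Type} [PartialOrder T] {glb : T → T → T} (h : IsGCA glb) {t s : T}
    (hts : t ≤ s) : glb t s = t :=
  (h t s).1.antisymm ((h t s).2.2 t le_rfl hts)

theorem IsGCA.comm {T : Type} [PartialOrder T] {glb : T → T → T} (h : IsGCA glb) (t s : T) :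
    glb t s = glb s t :=
  ((h s t).2.2 _ (h t s).2.1 (h t s).1).antisymm ((h t s).2.2 _ (h s t).2.1 (h s t).1)

theorem treeDist_eq_add {T : Type} [PartialOrder T] {q : ℝ} {α σ : T → ℝ} {glb : T → T → T}
    (h : IsGCA glb) (t s : T) :
    treeDist q α σ glb t s = dOrd q α σ (glb t s) t + dOrd q α σ (glb t s) s := by
  unfold treeDist
  split_ifs with hts hst
  · rw [h.eq_left hts, dOrd_self, zero_add]
  · rw [h.comm, h.eq_left hst, dOrd_self, add_zero]
  · rfl

theorem treeDist_of_le {T : Type} [PartialOrder T] {q : ℝ} {α σ : T → ℝ} {glb : T → T → T}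
    {t s : T} (hts : t ≤ s) : treeDist q α σ glb t s = dOrd q α σ t s :=
  if_pos hts

theorem treeDist_comm {T : Type} [PartialOrder T] {q : ℝ} {α σ : T → ℝ} {glb : T → T → T}
    (h : IsGCA glb) (t s : T) : treeDist q α σ glb t s = treeDist q α σ glb s t := by
  rw [treeDist_eq_add h, treeDist_eq_add h, h.comm, add_comm]

theorem stmt0 {T : Type} [Countable T] [PartialOrder T] [OrderBot T]
    (htree : IsTree T) (q : ℝ) (hq : 1 < q)
    (α σ : T → ℝ) (hα : ∀ t, 0 < α t) (hσpos : ∀ t, 0 < σ t)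
    (hσmono : ∀ ⦃t s : T⦄, t ≤ s → σ s ≤ σ t)
    (K : ℝ) (hK : ∀ s : T, (∑ᶠ r ∈ Set.Iic s, α r ^ q) ^ (1 / q) * σ s ≤ K)
    (glb : T → T → T) (hglb : IsGCA glb) :
    (∀ t s : T, 0 ≤ treeDist q α σ glb t s) ∧
    (∀ t s : T, treeDist q α σ glb t s = 0 ↔ t = s) ∧
    (∀ t s : T, treeDist q α σ glb t s = treeDist q α σ glb s t) ∧
    (∀ t r s : T, treeDist q α σ glb t s ≤
      treeDist q α σ glb t r + treeDist q α σ glb r s) ∧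
    (∀ t' t s s' : T, t' ≤ t → t ≤ s → s ≤ s' →
      treeDist q α σ glb t s ≤ treeDist q α σ glb t' s') := by
  obtain ⟨hfin, hchain, -⟩ := htree
  have hq0 : 0 < q := by linarith
  have hnonneg : ∀ t s : T, 0 ≤ dOrd q α σ t s := dOrd_nonneg hα hσpos
  have hmono : ∀ {t' t s s' : T}, t' ≤ t → s ≤ s' → dOrd q α σ t s ≤ dOrd q α σ t' s' :=
    fun ht hs => dOrd_mono hfin hq0 hα hσpos ht hs
  have htri : ∀ t r s : T, glb t r ≤ glb r s →
      treeDist q α σ glb t s ≤ treeDist q α σ glb t r + treeDist q α σ glb r s := by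
    intro t r s hab
    obtain ⟨hat, -, -⟩ := hglb t r
    obtain ⟨hbr, hbs, -⟩ := hglb r s
    have hg : glb t r ≤ glb t s := (hglb t s).2.2 _ hat (hab.trans hbs)
    simp only [treeDist_eq_add hglb]
    have hleft : dOrd q α σ (glb t s) t ≤ dOrd q α σ (glb t r) t := hmono hg le_rfl
    have hright : dOrd q α σ (glb t s) s ≤ dOrd q α σ (glb t r) s := hmono hg le_rfl
    have hsplit : dOrd q α σ (glb t r) s ≤
        dOrd q α σ (glb t r) (glb r s) + dOrd q α σ (glb r s) s :=
      dOrd_triangle hfin hchain hq.le hα hσpos hσmono hab hbs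
    have hmid : dOrd q α σ (glb t r) (glb r s) ≤ dOrd q α σ (glb t r) r := hmono le_rfl hbr
    linarith [hnonneg (glb r s) r]
  refine ⟨fun t s => ?_, fun t s => ⟨fun h => ?_, ?_⟩, treeDist_comm hglb, fun t r s => ?_,
    fun t' t s s' ht hts hs => ?_⟩
  · rw [treeDist_eq_add hglb]
    exact add_nonneg (hnonneg _ _) (hnonneg _ _)
  · rw [treeDist_eq_add hglb, add_eq_zero_iff_of_nonneg (hnonneg _ _) (hnonneg _ _)] at h
    have heq : ∀ {a b : T}, a ≤ b → dOrd q α σ a b = 0 → a = b := fun hab h0 =>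
      hab.eq_or_lt.resolve_right fun hlt => (dOrd_pos hfin hα hσpos hlt).ne' h0
    exact (heq (hglb t s).1 h.1).symm.trans (heq (hglb t s).2.1 h.2)
  · rintro rfl
    rw [treeDist_of_le le_rfl, dOrd_self]
  · rcases hchain r _ _ (hglb t r).2.1 (hglb r s).1 with hab | hba
    · exact htri t r s hab
    · rw [treeDist_comm hglb t s, treeDist_comm hglb t r, treeDist_comm hglb r s, add_comm]
      exact htri s r t (by rwa [hglb.comm s r, hglb.comm r t])
  · rw [treeDist_of_le hts, treeDist_of_le (ht.trans (hts.trans hs))]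
    exact hmono ht hs
end
end

section
/- Let σ take only dyadic values σ(s) = Σ_{m≥0} 2^{-m} 1_{I_m}(s) with I_m = {t : σ(t) = 2^{-m}}, and let W : ℓ_1(T) → ℓ_q(T) be the bounded operator with W(δ_t) = 2^{-m} Σ_{r⪯t, r∈I_m} α(r) δ_r for t ∈ I_m. Set p = min{2,q} and 1/p' = 1 − 1/p. (i) If Ñ(T,d,ε) ≤ c ε^{-a} |log ε|^b for some a > 0, b ≥ 0, c > 0 and all sufficiently small ε > 0, then there is c' > 0 with e_n(W) ≤ c' n^{-1/a − 1/p'} (log n)^{b/a} for all n ≥ 2. (ii) If instead log Ñ(T,d,ε) ≤ c ε^{-a}, then e_n(W) ≤ c' n^{-1/p'} (log n)^{1/p' − 1/a} for all n ≥ 2 when a < p', and e_n(W) ≤ c' n^{-1/a} when a > p'. -/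
open scoped ENNReal NNReal
open MeasureTheory

noncomputable section

/-- The binary tree: a rooted tree in which every node has exactly two offspring. -/
def IsBinaryTree (T : Type) [PartialOrder T] [OrderBot T] : Prop :=
  IsTree T ∧ ∀ t : T, Nat.card {s : T | t ⋖ s} = 2

/-- The generation `|t|` of a node: the number of its strict ancestors. -/
def gen {T : Type} [PartialOrder T] (t : T) : ℕ := Nat.card (Set.Iio t)

/-- `N(T,d,ε)`: minimal number of open `ε`-balls needed to cover `T` (`∞` if none). -/
def coveringNumber {T : Type} (d : T → T → ℝ) (ε : ℝ) : ℝ≥0∞ :=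
  ⨅ S ∈ {S : Finset T | ∀ t : T, ∃ s ∈ S, d s t < ε}, (S.card : ℝ≥0∞)

/-- `Ñ(T,d,ε)`: minimal cardinality of an order `ε`-net of `T`. -/
def orderCoveringNumber {T : Type} [PartialOrder T] (d : T → T → ℝ) (ε : ℝ) : ℝ≥0∞ :=
  ⨅ S ∈ {S : Finset T | ∀ t : T, ∃ s ∈ S, s ≤ t ∧ d s t < ε}, (S.card : ℝ≥0∞)

/-- Minimal number of open `ε`-balls of a normed space needed to cover the set `A`. -/
def setCoveringNumber {Y : Type} [NormedAddCommGroup Y] (A : Set Y) (ε : ℝ) : ℝ≥0∞ :=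
  ⨅ F ∈ {F : Finset Y | ∀ a ∈ A, ∃ y ∈ F, ‖a - y‖ < ε}, (F.card : ℝ≥0∞)

/-- The dyadic entropy numbers `e_n(V)` of an operator `V`. -/
def entropyNumber {X Y : Type} [NormedAddCommGroup X] [NormedSpace ℝ X]
    [NormedAddCommGroup Y] [NormedSpace ℝ Y] (n : ℕ) (V : X →L[ℝ] Y) : ℝ :=
  sInf {ε : ℝ | 0 < ε ∧ ∃ F : Finset Y, F.card ≤ 2 ^ (n - 1) ∧
    ∀ x : X, ‖x‖ ≤ 1 → ∃ y ∈ F, ‖V x - y‖ < ε}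

/-- The space `ℓ₁(T)`. -/
abbrev ellOne (T : Type) := lp (fun _ : T => ℝ) 1

/-- The space `ℓ_q(T)`. -/
abbrev ellQ (T : Type) (q : ℝ) := lp (fun _ : T => ℝ) (ENNReal.ofReal q)

/-- The two-point form of uniform smoothness of power type `p`. -/
def TwoPointSmooth (X : Type*) [NormedAddCommGroup X] (p C : ℝ) : Prop :=
  ∀ e h : X, ‖e + h‖ ^ p + ‖e - h‖ ^ p ≤ 2 * ‖e‖ ^ p + C * ‖h‖ ^ p

/-- The mean of two `u`-th powers is dominated by the corresponding power mean of exponent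
`v ≥ u`. -/
lemma half_add_rpow_le {u v x y : ℝ} (hu : 0 < u) (huv : u ≤ v) (hx : 0 ≤ x) (hy : 0 ≤ y) :
    (x ^ u + y ^ u) / 2 ≤ ((x ^ v + y ^ v) / 2) ^ (u / v) := by
  have hv : 0 < v := hu.trans_le huv
  have h := (convexOn_rpow ((one_le_div hu).2 huv)).2 (Set.mem_Ici.2 (Real.rpow_nonneg hx u))
    (Set.mem_Ici.2 (Real.rpow_nonneg hy u)) (by norm_num : (0 : ℝ) ≤ 1 / 2)
    (by norm_num : (0 : ℝ) ≤ 1 / 2) (by norm_num)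
  simp only [smul_eq_mul] at h
  rw [← Real.rpow_mul hx, ← Real.rpow_mul hy, mul_div_cancel₀ _ hu.ne'] at h
  have h2 := Real.rpow_le_rpow (by positivity) h (div_pos hu hv).le
  rw [← Real.rpow_mul (by positivity), div_mul_div_cancel₀ hu.ne', div_self hv.ne',
    Real.rpow_one] at h2
  calc _ = 1 / 2 * x ^ u + 1 / 2 * y ^ u := by ring
    _ ≤ _ := h2
    _ = _ := by congr 1; ring

lemma abs_add_rpow_add_abs_sub_rpow_le {q : ℝ} (hq : 0 < q) (hq2 : q ≤ 2) (a b : ℝ) :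
    |a + b| ^ q + |a - b| ^ q ≤ 2 * |a| ^ q + 2 * |b| ^ q := by
  have h := half_add_rpow_le hq hq2 (abs_nonneg (a + b)) (abs_nonneg (a - b))
  have e : (|a + b| ^ (2 : ℝ) + |a - b| ^ (2 : ℝ)) / 2 = |a| ^ (2 : ℝ) + |b| ^ (2 : ℝ) := by
    simp only [Real.rpow_two, sq_abs]; ring
  rw [e] at h
  have h2 := Real.rpow_add_le_add_rpow (p := q / 2) (a := |a| ^ (2 : ℝ)) (b := |b| ^ (2 : ℝ))
    (by positivity) (by positivity) (by positivity) (by linarith)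
  rw [← Real.rpow_mul (abs_nonneg a), ← Real.rpow_mul (abs_nonneg b),
    mul_div_cancel₀ _ (two_ne_zero)] at h2
  linarith

lemma half_one_add_rpow_le {q t : ℝ} (hq : 2 ≤ q) (ht : |t| ≤ 1) :
    ((1 + t) ^ q + (1 - t) ^ q) / 2 ≤ (1 + Real.exp q * t ^ 2) ^ (q / 2) := by
  obtain ⟨h1, h2⟩ := abs_le.1 ht
  have key : ∀ u : ℝ, -1 ≤ u → (1 + u) ^ q ≤ Real.exp (q * u) := by
    intro u hu
    calc (1 + u) ^ q ≤ Real.exp u ^ q :=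
          Real.rpow_le_rpow (by linarith) (by linarith [Real.add_one_le_exp u]) (by linarith)
      _ = Real.exp (q * u) := by rw [← Real.exp_mul, mul_comm]
  have hc : ((1 + t) ^ q + (1 - t) ^ q) / 2 ≤ Real.cosh (q * t) := by
    have k1 := key t h1
    have k2 := key (-t) (by linarith)
    rw [Real.cosh_eq, ← mul_neg]
    rw [← sub_eq_add_neg] at k2
    linarith
  have ht2 : t ^ 2 ≤ 1 := (sq_le_one_iff_abs_le_one t).2 ht
  have hconv : Real.exp (q * t ^ 2) ≤ 1 + Real.exp q * t ^ 2 := by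
    have := convexOn_exp.2 (Set.mem_univ q) (Set.mem_univ 0) (sq_nonneg t)
      (sub_nonneg.2 ht2) (by ring)
    simp only [smul_eq_mul, mul_zero, add_zero, Real.exp_zero, mul_one] at this
    rw [mul_comm q]
    nlinarith [sq_nonneg t]
  calc _ ≤ Real.cosh (q * t) := hc
    _ ≤ Real.exp ((q * t) ^ 2 / 2) := Real.cosh_le_exp_half_sq _
    _ = Real.exp (q * t ^ 2) ^ (q / 2) := by rw [← Real.exp_mul]; congr 1; ring
    _ ≤ _ := Real.rpow_le_rpow (Real.exp_pos _).le hconv (by linarith)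

lemma half_abs_add_rpow_le {q : ℝ} (hq : 2 ≤ q) (a b : ℝ) :
    (|a + b| ^ q + |a - b| ^ q) / 2 ≤ (a ^ 2 + Real.exp q * b ^ 2) ^ (q / 2) := by
  have h4 : 4 ≤ Real.exp q := by
    have h1 := Real.add_one_le_exp (1 : ℝ)
    have : Real.exp 2 = Real.exp 1 * Real.exp 1 := by rw [← Real.exp_add]; norm_num
    have h2 := Real.exp_le_exp.2 hq
    nlinarith
  have hsq : ∀ x : ℝ, |x| ^ q = (x ^ 2) ^ (q / 2) := by
    intro x
    rw [← sq_abs, ← Real.rpow_natCast, ← Real.rpow_mul (abs_nonneg x)]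
    congr 1; push_cast; ring
  rcases le_total |a| |b| with hab | hab
  · have k : ∀ x : ℝ, |x| ≤ 2 * |b| → |x| ^ q ≤ (a ^ 2 + Real.exp q * b ^ 2) ^ (q / 2) := by
      intro x hx
      rw [hsq]
      refine Real.rpow_le_rpow (sq_nonneg _) ?_ (by linarith)
      have : x ^ 2 ≤ (2 * |b|) ^ 2 := by rw [← sq_abs x]; gcongr
      rw [mul_pow, sq_abs] at this
      nlinarith [sq_nonneg a, sq_nonneg b]
    have k1 := k (a + b) (by linarith [abs_add_le a b])
    have k2 := k (a - b) (by linarith [abs_sub a b])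
    linarith
  · rcases eq_or_ne a 0 with rfl | ha
    · have hb : b = 0 := by simpa using hab
      subst hb
      simp [Real.zero_rpow (by linarith : q ≠ 0), Real.zero_rpow (by linarith : q / 2 ≠ 0)]
    have ha' : 0 < |a| := abs_pos.2 ha
    have ht : |b / a| ≤ 1 := by rw [abs_div, div_le_one ha']; exact hab
    obtain ⟨h1, h2⟩ := abs_le.1 ht
    have h := half_one_add_rpow_le hq ht
    have e1 : |a + b| = |a| * (1 + b / a) := by
      rw [← abs_of_nonneg (by linarith : 0 ≤ 1 + b / a), ← abs_mul]; congr 1; field_simp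
    have e2 : |a - b| = |a| * (1 - b / a) := by
      rw [← abs_of_nonneg (by linarith : 0 ≤ 1 - b / a), ← abs_mul]; congr 1; field_simp
    have e3 : a ^ 2 + Real.exp q * b ^ 2 = a ^ 2 * (1 + Real.exp q * (b / a) ^ 2) := by
      field_simp
    rw [e1, e2, e3, Real.mul_rpow ha'.le (by linarith), Real.mul_rpow ha'.le (by linarith),
      Real.mul_rpow (sq_nonneg a) (by positivity), ← hsq]
    calc _ = |a| ^ q * (((1 + b / a) ^ q + (1 - b / a) ^ q) / 2) := by ring
      _ ≤ _ := by gcongr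

section ellQ
variable {T : Type*} {q : ℝ}

lemma lp_norm_rpow (hq : 0 < q) (f : lp (fun _ : T => ℝ) (ENNReal.ofReal q)) :
    HasSum (fun r => |f r| ^ q) (‖f‖ ^ q) := by
  have hq' : (ENNReal.ofReal q).toReal = q := ENNReal.toReal_ofReal hq.le
  have h := lp.hasSum_norm (p := ENNReal.ofReal q) (by rw [hq']; exact hq) f
  rw [hq'] at h
  exact h

lemma twoPointSmooth_lp_of_le_two [Fact (1 ≤ ENNReal.ofReal q)] (hq : 0 < q) (hq2 : q ≤ 2) :
    TwoPointSmooth (lp (fun _ : T => ℝ) (ENNReal.ofReal q)) q 2 := by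
  intro e h
  refine hasSum_le ?_ ((lp_norm_rpow hq (e + h)).add (lp_norm_rpow hq (e - h)))
    (((lp_norm_rpow hq e).mul_left 2).add ((lp_norm_rpow hq h).mul_left 2))
  intro r
  exact abs_add_rpow_add_abs_sub_rpow_le hq hq2 (e r) (h r)

lemma twoPointSmooth_lp_of_two_le [Fact (1 ≤ ENNReal.ofReal q)] (hq2 : 2 ≤ q) :
    TwoPointSmooth (lp (fun _ : T => ℝ) (ENNReal.ofReal q)) 2 (2 * Real.exp q) := by
  have hq : 0 < q := by linarith
  have hsq : ∀ x : ℝ, |x| ^ q = (x ^ 2) ^ (q / 2) := by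
    intro x
    rw [← sq_abs, ← Real.rpow_natCast, ← Real.rpow_mul (abs_nonneg x)]
    congr 1; push_cast; ring
  intro e h
  have hE : HasSum (fun r => (e r ^ 2) ^ (q / 2)) (‖e‖ ^ q) := by
    simpa only [hsq] using lp_norm_rpow hq e
  have hH : HasSum (fun r => (Real.exp q * h r ^ 2) ^ (q / 2))
      (Real.exp q ^ (q / 2) * ‖h‖ ^ q) := by
    have := (lp_norm_rpow hq h).mul_left (Real.exp q ^ (q / 2))
    simpa only [hsq, Real.mul_rpow (Real.exp_pos q).le (sq_nonneg _)] using this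
  obtain ⟨hs, hle⟩ := Real.Lp_add_le_tsum_of_nonneg (p := q / 2) (by linarith)
    (fun r => sq_nonneg (e r)) (fun r => by positivity) hE.summable hH.summable
  rw [hE.tsum_eq, hH.tsum_eq] at hle
  have hn : ∀ x : ℝ, 0 ≤ x → (x ^ q) ^ (1 / (q / 2)) = x ^ (2 : ℝ) := by
    intro x hx
    rw [← Real.rpow_mul hx]; congr 1; field_simp
  rw [Real.mul_rpow (by positivity) (by positivity), hn _ (norm_nonneg _), hn _ (norm_nonneg _),
    ← Real.rpow_mul (Real.exp_pos q).le, mul_one_div_cancel (by linarith), Real.rpow_one] at hle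
  have hsum : (‖e + h‖ ^ q + ‖e - h‖ ^ q) / 2 ≤
      ∑' r, (e r ^ 2 + Real.exp q * h r ^ 2) ^ (q / 2) := by
    refine hasSum_le ?_ (((lp_norm_rpow hq (e + h)).add (lp_norm_rpow hq (e - h))).div_const 2)
      hs.hasSum
    intro r
    exact half_abs_add_rpow_le hq2 (e r) (h r)
  have hm := half_add_rpow_le two_pos hq2 (norm_nonneg (e + h)) (norm_nonneg (e - h))
  have hm2 := Real.rpow_le_rpow (by positivity) hsum (by positivity : (0 : ℝ) ≤ 2 / q)
  rw [one_div_div] at hle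
  linarith

end ellQ

section Maurey
variable {X : Type*} [NormedAddCommGroup X] [NormedSpace ℝ X] {p C : ℝ}

lemma TwoPointSmooth.exists_functional (hX : TwoPointSmooth X p C) (hp : 0 < p) (e : X) :
    ∃ φ : X →L[ℝ] ℝ, ∀ h, φ h ≤ 0 → ‖e + h‖ ^ p ≤ ‖e‖ ^ p + C * ‖h‖ ^ p := by
  obtain ⟨φ, hφ, he⟩ := exists_dual_vector'' ℝ e
  refine ⟨φ, fun h hh => ?_⟩
  have h1 : ‖e‖ ≤ ‖e - h‖ := by
    have h2 : φ (e - h) ≤ ‖e - h‖ :=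
      (le_abs_self _).trans ((φ.le_of_opNorm_le hφ _).trans (by rw [one_mul]))
    rw [map_sub, he] at h2
    simp only [RCLike.ofReal_real_eq_id, id_eq] at h2
    linarith
  have h3 := Real.rpow_le_rpow (norm_nonneg _) h1 hp.le
  linarith [hX e h]

/-- A derandomised form of Maurey's empirical method. -/
lemma TwoPointSmooth.exists_multiset (hX : TwoPointSmooth X p C) (hp : 0 < p) (hC : 0 ≤ C)
    {E : Finset X} {R : ℝ} (hE : ∀ y ∈ E, ‖y‖ ≤ R) {x : X} (hx : x ∈ convexHull ℝ (E : Set X))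
    (m : ℕ) : ∃ s : Sym E m, ‖((s : Multiset E).map Subtype.val).sum - (m : ℝ) • x‖ ^ p ≤
      C * m * (2 * R) ^ p := by
  have hxR : ‖x‖ ≤ R := by
    have : convexHull ℝ (E : Set X) ⊆ Metric.closedBall 0 R :=
      convexHull_min (fun y hy => by simpa using hE y hy) (convex_closedBall 0 R)
    simpa using this hx
  induction m with
  | zero => exact ⟨Sym.nil, by simp [Real.zero_rpow hp.ne']⟩
  | succ m ih =>
    obtain ⟨s, hs⟩ := ih
    set e := ((s : Multiset E).map Subtype.val).sum - (m : ℝ) • x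
    obtain ⟨φ, hφ⟩ := hX.exists_functional hp e
    obtain ⟨y, hy, hyx⟩ : ∃ y ∈ E, φ y ≤ φ x := by
      by_contra! hcon
      have : convexHull ℝ (E : Set X) ⊆ {z | φ x < φ z} :=
        convexHull_min (fun y hy => hcon y hy)
          (convex_halfSpace_gt φ.toLinearMap.isLinear (φ x))
      exact lt_irrefl (φ x) (this hx)
    refine ⟨(⟨y, hy⟩ : E) ::ₛ s, ?_⟩
    have h1 := hφ (y - x) (by rw [map_sub]; linarith)
    have h2 : ‖y - x‖ ≤ 2 * R := (norm_sub_le _ _).trans (by linarith [hE y hy])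
    have h3 : ‖y - x‖ ^ p ≤ (2 * R) ^ p := Real.rpow_le_rpow (norm_nonneg _) h2 hp.le
    have e1 : (((((⟨y, hy⟩ : E) ::ₛ s : Sym E (m + 1)) : Multiset E)).map Subtype.val).sum
        - ((m + 1 : ℕ) : ℝ) • x = e + (y - x) := by
      simp only [Sym.coe_cons, Multiset.map_cons, Multiset.sum_cons, e]
      push_cast
      rw [add_smul, one_smul]
      abel
    rw [e1]
    push_cast
    nlinarith

end Maurey

/-- The set `s` can be covered by at most `exp L` closed balls of radius `r`. -/
def HasCover {X : Type*} [NormedAddCommGroup X] (s : Set X) (r L : ℝ) : Prop :=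
  ∃ F : Finset X, (F.card : ℝ) ≤ Real.exp L ∧ ∀ x ∈ s, ∃ y ∈ F, ‖x - y‖ ≤ r

section Cover
variable {X : Type*} [NormedAddCommGroup X]

lemma HasCover.mono {s t : Set X} {r r' L L' : ℝ} (h : HasCover s r L) (hst : t ⊆ s)
    (hr : r ≤ r') (hL : L ≤ L') : HasCover t r' L' := by
  obtain ⟨F, hF, hc⟩ := h
  refine ⟨F, hF.trans (Real.exp_le_exp.2 hL), fun x hx => ?_⟩
  obtain ⟨y, hy, hxy⟩ := hc x (hst hx)
  exact ⟨y, hy, hxy.trans hr⟩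

open Pointwise in
lemma HasCover.add {s t : Set X} {r r' L L' : ℝ} (hs : HasCover s r L) (ht : HasCover t r' L') :
    HasCover (s + t) (r + r') (L + L') := by
  classical
  obtain ⟨F, hF, hFc⟩ := hs
  obtain ⟨G, hG, hGc⟩ := ht
  refine ⟨F + G, ?_, ?_⟩
  · rw [Real.exp_add]
    calc ((F + G).card : ℝ) ≤ (F.card * G.card : ℕ) := by exact_mod_cast Finset.card_add_le
      _ ≤ _ := by push_cast; gcongr
  · rintro _ ⟨x, hx, y, hy, rfl⟩
    obtain ⟨f, hf, hxf⟩ := hFc x hx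
    obtain ⟨g, hg, hyg⟩ := hGc y hy
    refine ⟨f + g, Finset.add_mem_add hf hg, ?_⟩
    change ‖x + y - (f + g)‖ ≤ _
    rw [add_sub_add_comm]
    exact (norm_add_le _ _).trans (add_le_add hxf hyg)

lemma hasCover_of_norm_le {s : Set X} {r L : ℝ} (hs : ∀ x ∈ s, ‖x‖ ≤ r) (hL : 0 ≤ L) :
    HasCover s r L :=
  ⟨{0}, by simpa using hL, fun x hx => ⟨0, by simp, by simpa using hs x hx⟩⟩

end Cover

section Volume
variable {V : Type*} [NormedAddCommGroup V] [NormedSpace ℝ V] [FiniteDimensional ℝ V]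

lemma exists_finset_cover_half :
    ∃ F : Finset V, F.card ≤ 5 ^ Module.finrank ℝ V ∧
      ∀ x : V, ‖x‖ ≤ 1 → ∃ y ∈ F, ‖x - y‖ ≤ 1 / 2 := by
  classical
  let P : ℕ → Prop := fun k => ∃ s : Finset V, s.card = k ∧ (∀ c ∈ s, ‖c‖ ≤ 2) ∧
    ∀ c ∈ s, ∀ d ∈ s, c ≠ d → 1 ≤ ‖c - d‖
  have hP0 : P 0 := ⟨∅, by simp⟩
  obtain ⟨s, hcard, hs, hsep⟩ : P (Nat.findGreatest P (5 ^ Module.finrank ℝ V)) :=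
    Nat.findGreatest_spec (Nat.zero_le _) hP0
  refine ⟨s.image fun y => (1 / 2 : ℝ) • y,
    Finset.card_image_le.trans (Besicovitch.card_le_of_separated s hs hsep), fun x hx => ?_⟩
  suffices h : ∃ y ∈ s, ‖(2 : ℝ) • x - y‖ ≤ 1 by
    obtain ⟨y, hy, hxy⟩ := h
    refine ⟨_, Finset.mem_image_of_mem _ hy, ?_⟩
    have : x - (1 / 2 : ℝ) • y = (1 / 2 : ℝ) • ((2 : ℝ) • x - y) := by
      rw [smul_sub, smul_smul]; norm_num
    rw [this, norm_smul, Real.norm_of_nonneg (by norm_num)]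
    linarith
  by_contra! hcon
  have hns : (2 : ℝ) • x ∉ s := fun h => by simpa using (hcon _ h).le.trans_lt' one_pos
  have h2 : ‖(2 : ℝ) • x‖ ≤ 2 := by
    rw [norm_smul, Real.norm_of_nonneg (by norm_num)]; linarith
  have hb : ∀ c ∈ insert ((2 : ℝ) • x) s, ‖c‖ ≤ 2 := by
    intro c hc
    rcases Finset.mem_insert.1 hc with rfl | hc
    exacts [h2, hs c hc]
  have hsep' : ∀ c ∈ insert ((2 : ℝ) • x) s, ∀ d ∈ insert ((2 : ℝ) • x) s,
      c ≠ d → 1 ≤ ‖c - d‖ := by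
    intro c hc d hd hcd
    rcases Finset.mem_insert.1 hc with rfl | hc <;> rcases Finset.mem_insert.1 hd with rfl | hd
    · exact absurd rfl hcd
    · exact (hcon d hd).le
    · rw [norm_sub_rev]; exact (hcon c hc).le
    · exact hsep c hc d hd hcd
  have hle := Besicovitch.card_le_of_separated _ hb hsep'
  have := Nat.le_findGreatest (P := P) hle ⟨_, rfl, hb, hsep'⟩
  rw [Finset.card_insert_of_notMem hns, hcard] at this
  omega

lemma exists_finset_cover_pow (l : ℕ) :
    ∃ F : Finset V, F.card ≤ 5 ^ (Module.finrank ℝ V * l) ∧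
      ∀ x : V, ‖x‖ ≤ 1 → ∃ y ∈ F, ‖x - y‖ ≤ (1 / 2) ^ l := by
  classical
  obtain ⟨G, hG, hGc⟩ := exists_finset_cover_half (V := V)
  induction l with
  | zero => exact ⟨{0}, by simp, fun x hx => ⟨0, by simp, by simpa using hx⟩⟩
  | succ l ih =>
    obtain ⟨F, hF, hFc⟩ := ih
    refine ⟨(F ×ˢ G).image fun z => z.1 + ((1 / 2 : ℝ) ^ l) • z.2, ?_, fun x hx => ?_⟩
    · refine Finset.card_image_le.trans ?_
      rw [Finset.card_product, mul_add, pow_add, mul_one]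
      exact Nat.mul_le_mul hF hG
    · obtain ⟨y, hy, hxy⟩ := hFc x hx
      have h1 : ‖(2 : ℝ) ^ l • (x - y)‖ ≤ 1 := by
        rw [norm_smul, Real.norm_of_nonneg (by positivity)]
        calc (2 : ℝ) ^ l * ‖x - y‖ ≤ 2 ^ l * (1 / 2) ^ l := by gcongr
          _ = 1 := by rw [← mul_pow]; norm_num
      obtain ⟨z, hz, hxz⟩ := hGc _ h1
      refine ⟨_, Finset.mem_image_of_mem _ (Finset.mk_mem_product hy hz), ?_⟩
      have e : x - (y + ((1 / 2 : ℝ) ^ l) • z) =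
          ((1 / 2 : ℝ) ^ l) • ((2 : ℝ) ^ l • (x - y) - z) := by
        rw [smul_sub, smul_smul, ← mul_pow]; norm_num; abel
      dsimp only
      rw [e, norm_smul, Real.norm_of_nonneg (by positivity), pow_succ]
      gcongr

end Volume

section Hull
variable {X : Type*} [NormedAddCommGroup X] [NormedSpace ℝ X]

lemma five_pow_le_exp (k : ℕ) : (5 : ℝ) ^ k ≤ Real.exp (2 * k) := by
  have h5 : (5 : ℝ) ≤ Real.exp 2 := by
    have h1 := Real.exp_one_gt_d9
    have : Real.exp 2 = Real.exp 1 * Real.exp 1 := by rw [← Real.exp_add]; norm_num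
    nlinarith
  rw [mul_comm, Real.exp_nat_mul]
  exact pow_le_pow_left₀ (by norm_num) h5 k

/-- Covers with centres in a finite-dimensional subspace can be refined. -/
lemma HasCover.of_subset_submodule (V : Submodule ℝ X) [FiniteDimensional ℝ V] {s : Set X}
    (hs : s ⊆ V) {r L N : ℝ} (hr : 0 < r) {G : Finset X} (hGV : ∀ g ∈ G, g ∈ V)
    (hG : (G.card : ℝ) ≤ Real.exp L) (hcov : ∀ x ∈ s, ∃ y ∈ G, ‖x - y‖ ≤ r)
    (hN : (Module.finrank ℝ V : ℝ) ≤ N) (l : ℕ) :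
    HasCover s (r * (1 / 2) ^ l) (L + 2 * N * l) := by
  classical
  obtain ⟨F, hF, hFc⟩ := exists_finset_cover_pow (V := V) l
  refine ⟨(G ×ˢ F).image fun z => z.1 + r • (z.2 : X), ?_, fun x hx => ?_⟩
  · rw [Real.exp_add]
    calc _ ≤ ((G.card * F.card : ℕ) : ℝ) := by
          rw [← Finset.card_product]; exact_mod_cast Finset.card_image_le
      _ ≤ Real.exp L * 5 ^ (Module.finrank ℝ V * l) := by
          push_cast
          gcongr
          exact_mod_cast hF
      _ ≤ Real.exp L * Real.exp (2 * N * l) := by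
          gcongr
          refine (five_pow_le_exp _).trans (Real.exp_le_exp.2 ?_)
          push_cast
          rw [mul_assoc]
          gcongr
  · obtain ⟨y, hy, hxy⟩ := hcov x hx
    have hmem : r⁻¹ • (x - y) ∈ V := V.smul_mem _ (V.sub_mem (hs hx) (hGV y hy))
    have h1 : ‖(⟨r⁻¹ • (x - y), hmem⟩ : V)‖ ≤ 1 := by
      rw [Submodule.coe_norm, norm_smul, Real.norm_of_nonneg (by positivity)]
      rwa [inv_mul_le_one₀ hr]
    obtain ⟨z, hz, hxz⟩ := hFc _ h1
    refine ⟨_, Finset.mem_image_of_mem _ (Finset.mk_mem_product hy hz), ?_⟩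
    have e : x - (y + r • (z : X)) = r • (r⁻¹ • (x - y) - z) := by
      rw [smul_sub, smul_inv_smul₀ hr.ne']; abel
    dsimp only
    rw [e, norm_smul, Real.norm_of_nonneg hr.le]
    gcongr
    simpa [Submodule.coe_norm] using hxz

lemma choose_le_exp {M m : ℕ} {x : ℝ} (hM : 0 < M) (hx : 0 < x) (hm : (m : ℝ) ≤ x) :
    ((M + m).choose m : ℝ) ≤ Real.exp (x * (1 + Real.log (1 + M / x))) := by
  have hM' : (0 : ℝ) < M := by exact_mod_cast hM
  set t : ℝ := x / M with ht
  have htp : 0 < t := by positivity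
  have h1 : ((M + m).choose m : ℝ) * t ^ m ≤ (1 + t) ^ (M + m) := by
    rw [add_comm 1 t, add_pow]
    have := Finset.single_le_sum (f := fun k => t ^ k * 1 ^ (M + m - k) * ((M + m).choose k : ℝ))
      (s := Finset.range (M + m + 1)) (fun k _ => by positivity)
      (Finset.mem_range.2 (by omega : m < M + m + 1))
    simpa [mul_comm] using this
  have h2 : (1 + t) ^ M ≤ Real.exp x := by
    calc (1 + t) ^ M ≤ Real.exp t ^ M :=
          pow_le_pow_left₀ (by positivity) (by linarith [Real.add_one_le_exp t]) _
      _ = Real.exp x := by rw [← Real.exp_nat_mul]; congr 1; rw [ht]; field_simp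
  have h3 : ((1 + t) / t) ^ m ≤ Real.exp (x * Real.log (1 + M / x)) := by
    have e : (1 + t) / t = 1 + M / x := by rw [ht]; field_simp; ring
    rw [e, mul_comm, Real.exp_mul, Real.exp_log (by positivity), ← Real.rpow_natCast]
    exact Real.rpow_le_rpow_of_exponent_le (by linarith [div_pos hM' hx]) hm
  calc ((M + m).choose m : ℝ) ≤ (1 + t) ^ (M + m) / t ^ m := by rwa [le_div_iff₀ (by positivity)]
    _ = (1 + t) ^ M * ((1 + t) / t) ^ m := by rw [pow_add, div_pow (1 + t), mul_div_assoc]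
    _ ≤ Real.exp x * Real.exp (x * Real.log (1 + M / x)) := by gcongr
    _ = _ := by rw [← Real.exp_add]; congr 1; ring

/-- Entropy estimate for absolutely convex hulls of finite sets, of order `s`. -/
def HullEntropy (X : Type*) [NormedAddCommGroup X] [NormedSpace ℝ X] (s C : ℝ) : Prop :=
  ∀ (D : Finset X) (N R x : ℝ) (l : ℕ), (D.card : ℝ) ≤ N → 0 < R → 0 < x →
    (∀ d ∈ D, ‖d‖ ≤ R) → HasCover (absConvexHull ℝ (D : Set X))
      (C * R * x ^ (-s) * (1 / 2) ^ l) (x * (1 + Real.log (1 + 2 * N / x)) + 2 * N * l)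

lemma TwoPointSmooth.hullEntropy {p C : ℝ} (hX : TwoPointSmooth X p C) (hp : 1 ≤ p)
    (hC : 1 ≤ C) : HullEntropy X (1 - 1 / p) (4 * C) := by
  classical
  intro D N R x l hN hR hx hD
  have hp0 : 0 < p := by linarith
  have hs0 : 0 ≤ 1 - 1 / p := sub_nonneg.2 ((div_le_one hp0).2 hp)
  have hs1 : 1 - 1 / p ≤ 1 := by have : 0 < 1 / p := by positivity
                                 linarith
  rcases D.eq_empty_or_nonempty with rfl | hne
  · exact ⟨∅, by simpa using (Real.exp_pos _).le, by simp⟩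
  set s := 1 - 1 / p
  set V := Submodule.span ℝ (D : Set X)
  have hVD : absConvexHull ℝ (D : Set X) ⊆ V :=
    absConvexHull_min Submodule.subset_span ⟨by
      rintro a - _ ⟨y, hy, rfl⟩
      exact V.smul_mem _ hy, V.convex⟩
  set E : Finset X := D ∪ D.image Neg.neg with hEdef
  have hEcoe : (E : Set X) = (D : Set X) ∪ -(D : Set X) := by
    rw [hEdef]; simp
  have hE : ∀ y ∈ E, ‖y‖ ≤ R := by
    intro y hy
    rcases Finset.mem_union.1 hy with h | h
    · exact hD y h
    · obtain ⟨z, hz, rfl⟩ := Finset.mem_image.1 h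
      simpa using hD z hz
  have hEV : ∀ y ∈ E, y ∈ V := by
    intro y hy
    rcases Finset.mem_union.1 hy with h | h
    · exact Submodule.subset_span h
    · obtain ⟨z, hz, rfl⟩ := Finset.mem_image.1 h
      exact V.neg_mem (Submodule.subset_span hz)
  have hEcard : E.card ≤ 2 * D.card :=
    (Finset.card_union_le _ _).trans (by have := Finset.card_image_le (s := D) (f := Neg.neg)
                                         omega)
  have hEpos : 0 < E.card := Finset.card_pos.2 (hne.mono Finset.subset_union_left)
  set m := ⌊x⌋₊
  have hmx : (m : ℝ) ≤ x := Nat.floor_le hx.le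
  have hxm : x < m + 1 := Nat.lt_floor_add_one x
  let c : Sym E m → X := fun s => (m : ℝ)⁻¹ • ((s : Multiset E).map Subtype.val).sum
  refine HasCover.of_subset_submodule V hVD (G := Finset.univ.image c) (by positivity) ?_ ?_ ?_
    (le_trans (by exact_mod_cast finrank_span_finset_le_card D) hN) l
  · intro g hg
    obtain ⟨t, -, rfl⟩ := Finset.mem_image.1 hg
    refine V.smul_mem _ (multiset_sum_mem _ ?_)
    intro a ha
    obtain ⟨b, -, rfl⟩ := Multiset.mem_map.1 ha
    exact hEV b b.2
  · have h1 : (Finset.univ.image c).card ≤ (E.card + m).choose m := by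
      refine Finset.card_image_le.trans ?_
      rw [Finset.card_univ, Sym.card_sym_eq_multichoose, Nat.multichoose_eq, Fintype.card_coe]
      exact Nat.choose_le_choose _ (by omega)
    calc ((Finset.univ.image c).card : ℝ) ≤ ((E.card + m).choose m : ℝ) := by exact_mod_cast h1
      _ ≤ _ := choose_le_exp hEpos hx hmx
      _ ≤ _ := by
          have : (E.card : ℝ) ≤ 2 * N := by
            have : (E.card : ℝ) ≤ 2 * D.card := by exact_mod_cast hEcard
            linarith
          gcongr
  · intro y hy
    rw [← convexHull_union_neg_eq_absConvexHull, ← hEcoe] at hy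
    obtain ⟨t, ht⟩ := hX.exists_multiset hp0 (by linarith) hE hy m
    refine ⟨c t, Finset.mem_image_of_mem _ (Finset.mem_univ t), ?_⟩
    rcases Nat.eq_zero_or_pos m with hm0 | hm0
    · have hx1 : x < 1 := by simpa [hm0] using hxm
      have hc0 : c t = 0 := by simp [c, hm0]
      have hyR : ‖y‖ ≤ R := by
        have : convexHull ℝ (E : Set X) ⊆ Metric.closedBall 0 R :=
          convexHull_min (fun y hy => by simpa using hE y hy) (convex_closedBall 0 R)
        simpa using this hy
      have h1 : 1 ≤ x ^ (-s) := Real.one_le_rpow_of_pos_of_le_one_of_nonpos hx hx1.le (by linarith)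
      rw [hc0, sub_zero]
      calc ‖y‖ ≤ 1 * R * 1 := by linarith
        _ ≤ 4 * C * R * x ^ (-s) := by gcongr; linarith
    · have hm : (0 : ℝ) < m := by exact_mod_cast hm0
      have hm1 : (1 : ℝ) ≤ m := by exact_mod_cast hm0
      have e : y - c t = -((m : ℝ)⁻¹ • (((t : Multiset E).map Subtype.val).sum - (m : ℝ) • y)) := by
        rw [smul_sub, inv_smul_smul₀ hm.ne']; simp [c]
      have h1 : ‖((t : Multiset E).map Subtype.val).sum - (m : ℝ) • y‖ ≤
          C * (m : ℝ) ^ (1 / p) * (2 * R) := by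
        rw [← Real.rpow_le_rpow_iff (norm_nonneg _) (by positivity) hp0]
        refine ht.trans ?_
        rw [Real.mul_rpow (x := C * _) (by positivity) (by positivity),
          Real.mul_rpow (x := C) (by positivity) (by positivity), ← Real.rpow_mul hm.le,
          one_div_mul_cancel hp0.ne', Real.rpow_one]
        gcongr
        exact Real.self_le_rpow_of_one_le hC hp
      have h2 : (m : ℝ)⁻¹ * (m : ℝ) ^ (1 / p) = (m : ℝ) ^ (-s) := by
        rw [← Real.rpow_neg_one, ← Real.rpow_add hm]; congr 1; simp only [s]; ring
      have h3 : (m : ℝ) ^ (-s) ≤ 2 * x ^ (-s) := by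
        calc (m : ℝ) ^ (-s) ≤ (x / 2) ^ (-s) :=
              Real.rpow_le_rpow_of_nonpos (by positivity) (by linarith) (by linarith)
          _ = 2 ^ s * x ^ (-s) := by
              rw [Real.div_rpow hx.le (by norm_num), Real.rpow_neg (by norm_num : (0 : ℝ) ≤ 2)]
              field_simp
          _ ≤ 2 ^ (1 : ℝ) * x ^ (-s) := by
              gcongr
              norm_num
          _ = _ := by rw [Real.rpow_one]
      rw [e, norm_neg, norm_smul, norm_inv, Real.norm_of_nonneg hm.le]
      calc _ ≤ (m : ℝ)⁻¹ * (C * (m : ℝ) ^ (1 / p) * (2 * R)) := by gcongr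
        _ = C * (2 * R) * ((m : ℝ)⁻¹ * (m : ℝ) ^ (1 / p)) := by ring
        _ ≤ C * (2 * R) * (2 * x ^ (-s)) := by rw [h2]; gcongr
        _ = _ := by ring

open Pointwise in
lemma absConvexHull_subset_add {s t u : Set X} (h : s ⊆ t + u) :
    absConvexHull ℝ s ⊆ absConvexHull ℝ t + absConvexHull ℝ u :=
  (absConvexHull_mono h).trans (absConvexHull_add_subset ℝ)

/-- Chaining along a finite sequence of nets. -/
lemma HullEntropy.hasCover_chain {s C : ℝ} (hX : HullEntropy X s C) (S : ℕ → Finset X)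
    (hS0 : S 0 = {0}) (N r x : ℕ → ℝ) (l : ℕ → ℕ) (hN : ∀ k, ((S (k + 1)).card : ℝ) ≤ N k)
    (hr : ∀ k, 0 < r k) (hx : ∀ k, 0 < x k)
    (hS : ∀ k, ∀ y ∈ S (k + 1), ∃ z ∈ S k, ‖y - z‖ ≤ r k) (K : ℕ) :
    HasCover (absConvexHull ℝ (S K : Set X))
      (∑ k ∈ Finset.range K, C * r k * x k ^ (-s) * (1 / 2) ^ l k)
      (∑ k ∈ Finset.range K,
        (x k * (1 + Real.log (1 + 2 * N k / x k)) + 2 * N k * l k)) := by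
  classical
  induction K with
  | zero =>
    rw [hS0]
    refine hasCover_of_norm_le (fun y hy => ?_) le_rfl
    have : absConvexHull ℝ (({0} : Finset X) : Set X) ⊆ {0} :=
      absConvexHull_min (by simp) ⟨balanced_zero, convex_singleton 0⟩
    simpa using this hy
  | succ K ih =>
    choose! π hπ hπr using hS K
    set D := (S (K + 1)).image fun y => y - π y
    have hD := hX D (N K) (r K) (x K) (l K)
      ((Nat.cast_le.2 Finset.card_image_le).trans (hN K)) (hr K) (hx K) (by
        intro d hd
        obtain ⟨y, hy, rfl⟩ := Finset.mem_image.1 hd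
        exact hπr y hy)
    rw [Finset.sum_range_succ, Finset.sum_range_succ]
    refine (ih.add hD).mono (absConvexHull_subset_add fun y hy => ?_) le_rfl le_rfl
    exact ⟨π y, hπ y hy, y - π y, Finset.mem_coe.2 (Finset.mem_image_of_mem _ hy), by simp⟩

/-- Passing from a net to the whole set. -/
lemma HasCover.of_net {A S : Set X} {r ρ L : ℝ} (h : HasCover (absConvexHull ℝ S) r L)
    (hA : ∀ a ∈ A, ∃ y ∈ S, ‖a - y‖ ≤ ρ) : HasCover (absConvexHull ℝ A) (r + ρ) L := by
  have hb : HasCover (absConvexHull ℝ (Metric.closedBall (0 : X) ρ)) ρ 0 := by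
    refine hasCover_of_norm_le (fun y hy => ?_) le_rfl
    have : absConvexHull ℝ (Metric.closedBall (0 : X) ρ) ⊆ Metric.closedBall 0 ρ :=
      absConvexHull_min le_rfl ⟨balanced_closedBall_zero, convex_closedBall 0 ρ⟩
    simpa using this hy
  refine (h.add hb).mono (absConvexHull_subset_add fun a ha => ?_) le_rfl (by simp)
  obtain ⟨y, hy, hay⟩ := hA a ha
  exact ⟨y, hy, a - y, by simpa using hay, by simp⟩

end Hull

section Rates
variable {X : Type*} [NormedAddCommGroup X] [NormedSpace ℝ X]

/-- A sequence of finite nets of the set `A`, starting with the trivial net `{0}`, of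
cardinality at most `N k` and mesh at most `ε k`. -/
structure IsNetSeq (A : Set X) (S : ℕ → Finset X) (N ε : ℕ → ℝ) : Prop where
  zero : S 0 = {0}
  subset : ∀ k, (S k : Set X) ⊆ A
  card_le : ∀ k, ((S k).card : ℝ) ≤ N k
  exists_norm_sub_le : ∀ k, ∀ a ∈ A, ∃ y ∈ S k, ‖a - y‖ ≤ ε k

lemma IsNetSeq.hasCover {A : Set X} {S : ℕ → Finset X} {N ε : ℕ → ℝ} (hS : IsNetSeq A S N ε)
    {s C : ℝ} (hX : HullEntropy X s C) (hε : ∀ k, 0 < ε k) (x : ℕ → ℝ) (hx : ∀ k, 0 < x k)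
    (l : ℕ → ℕ) (K : ℕ) :
    HasCover (absConvexHull ℝ A)
      (∑ k ∈ Finset.range K, C * ε k * x k ^ (-s) * (1 / 2) ^ l k + ε K)
      (∑ k ∈ Finset.range K,
        (x k * (1 + Real.log (1 + 2 * N (k + 1) / x k)) + 2 * N (k + 1) * l k)) :=
  (hX.hasCover_chain S hS.zero (fun k => N (k + 1)) ε x l (fun k => hS.card_le (k + 1)) hε hx
    (fun k y hy => hS.exists_norm_sub_le k y (hS.subset (k + 1) hy)) K).of_net
    (hS.exists_norm_sub_le K)

lemma summable_rpow_mul_geometric {β r : ℝ} (hr0 : 0 < r) (hr : r < 1) :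
    Summable fun j : ℕ => ((j : ℝ) + 1) ^ β * r ^ j := by
  obtain ⟨P, hP⟩ := exists_nat_ge β
  have h1 : Summable fun j : ℕ => (((j + 1 : ℕ) : ℝ)) ^ P * r ^ (j + 1) :=
    (summable_nat_add_iff (f := fun j : ℕ => (j : ℝ) ^ P * r ^ j) 1).2
      (summable_pow_mul_geometric_of_norm_lt_one P (by rwa [Real.norm_of_nonneg hr0.le]))
  refine Summable.of_nonneg_of_le (fun j => by positivity) (fun j => ?_) (h1.mul_left r⁻¹)
  have h2 : ((j : ℝ) + 1) ^ β ≤ ((j : ℝ) + 1) ^ P := by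
    rw [← Real.rpow_natCast]
    exact Real.rpow_le_rpow_of_exponent_le (by linarith [j.cast_nonneg (α := ℝ)]) hP
  calc _ ≤ ((j : ℝ) + 1) ^ P * r ^ j := by gcongr
    _ = _ := by push_cast; field_simp; ring

lemma sum_range_sub_le_tsum {f : ℕ → ℝ} (hf : ∀ j, 0 ≤ f j) (hs : Summable f) (m : ℕ) :
    ∑ k ∈ Finset.range m, f (m - k) ≤ ∑' j, f j := by
  have h1 : ∑ k ∈ Finset.range m, f (m - k) = ∑ j ∈ Finset.range m, f (j + 1) := by
    rw [← Finset.sum_range_reflect]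
    refine Finset.sum_congr rfl fun k hk => ?_
    have := Finset.mem_range.1 hk
    congr 1; omega
  have h2 : ∑ j ∈ Finset.range m, f (j + 1) ≤ ∑ j ∈ Finset.range (m + 1), f j := by
    rw [Finset.sum_range_succ']; linarith [hf 0]
  rw [h1]
  exact h2.trans (hs.sum_le_tsum _ fun j _ => hf j)

lemma two_rpow_mul_natCast (t : ℝ) (j : ℕ) : (2 : ℝ) ^ (t * j) = ((2 : ℝ) ^ t) ^ j := by
  rw [Real.rpow_mul (by norm_num), Real.rpow_natCast]

lemma two_rpow_neg_mem {t : ℝ} (ht : 0 < t) : 0 < (2 : ℝ) ^ (-t) ∧ (2 : ℝ) ^ (-t) < 1 :=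
  ⟨by positivity, Real.rpow_lt_one_of_one_lt_of_neg (by norm_num) (by linarith)⟩

lemma summable_two_rpow {t : ℝ} (ht : 0 < t) : Summable fun j : ℕ => (2 : ℝ) ^ (-t * j) := by
  simp only [two_rpow_mul_natCast]
  exact summable_geometric_of_lt_one (two_rpow_neg_mem ht).1.le (two_rpow_neg_mem ht).2

/-- Exponential growth of the nets with a mesh decaying slower than the critical rate. -/
lemma IsNetSeq.hasCover_of_exp_slow {A : Set X} {S : ℕ → Finset X} {B R u s C : ℝ} (hB : 1 ≤ B)
    (hR : 0 < R) (hC : 0 < C) (hu : 0 < u) (hus : u < s) (hs1 : s ≤ 1) (hX : HullEntropy X s C)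
    (hS : IsNetSeq A S (fun k => Real.exp (B * 2 ^ k)) (fun k => R * 2 ^ (-u * (k : ℝ)))) :
    ∃ C' > 0, ∃ L > 0, ∀ K : ℕ,
      HasCover (absConvexHull ℝ A) (C' * 2 ^ (-u * (K : ℝ))) (L * 2 ^ K) := by
  set τ := (s - u) / 2 with hτ
  have hτ0 : 0 < τ := by linarith
  have hγ : 0 < s - u - s * τ := by nlinarith
  set f : ℕ → ℝ := fun j => 2 ^ (-(s - u - s * τ) * (j : ℝ))
  set g : ℕ → ℝ := fun j => 2 ^ (-τ * (j : ℝ))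
  have hf0 : ∀ j, 0 ≤ f j := fun j => by positivity
  have hg0 : ∀ j, 0 ≤ g j := fun j => by positivity
  have hf : Summable f := summable_two_rpow hγ
  have hg : Summable g := summable_two_rpow hτ0
  have hF0 : 0 ≤ ∑' j, f j := tsum_nonneg hf0
  have hG0 : 0 ≤ ∑' j, g j := tsum_nonneg hg0
  refine ⟨C * R * (∑' j, f j) + R, by positivity, (2 * B + 3) * (∑' j, g j) + 1, by positivity,
    fun K => ?_⟩
  refine (hS.hasCover hX (fun k => by positivity) (fun k => 2 ^ ((1 - τ) * ((K : ℝ) - k)))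
    (fun k => by positivity) (fun _ => 0) K).mono le_rfl ?_ ?_
  · have : ∑ k ∈ Finset.range K, C * (R * (2 : ℝ) ^ (-u * (k : ℝ))) *
        ((2 : ℝ) ^ ((1 - τ) * ((K : ℝ) - k))) ^ (-s) * (1 / 2) ^ 0 =
        C * R * 2 ^ (-u * (K : ℝ)) * ∑ k ∈ Finset.range K, f (K - k) := by
      rw [Finset.mul_sum]
      refine Finset.sum_congr rfl fun k hk => ?_
      have hk' := (Finset.mem_range.1 hk).le
      simp only [f]
      rw [← Real.rpow_mul (by norm_num), pow_zero, mul_one, Nat.cast_sub hk']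
      have e : (2 : ℝ) ^ (-u * (k : ℝ)) * 2 ^ ((1 - τ) * ((K : ℝ) - k) * -s) =
          2 ^ (-u * (K : ℝ)) * 2 ^ (-(s - u - s * τ) * ((K : ℝ) - k)) := by
        rw [← Real.rpow_add (by norm_num), ← Real.rpow_add (by norm_num)]; congr 1; ring
      linear_combination C * R * e
    rw [this]
    have h1 := sum_range_sub_le_tsum hf0 hf K
    have h2 : C * R * 2 ^ (-u * (K : ℝ)) * ∑ k ∈ Finset.range K, f (K - k) ≤
        C * R * 2 ^ (-u * (K : ℝ)) * ∑' j, f j := by gcongr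
    linarith
  · have : ∀ k ∈ Finset.range K, (2 : ℝ) ^ ((1 - τ) * ((K : ℝ) - k)) *
        (1 + Real.log (1 + 2 * Real.exp (B * 2 ^ (k + 1)) / 2 ^ ((1 - τ) * ((K : ℝ) - k)))) +
          2 * Real.exp (B * 2 ^ (k + 1)) * ((0 : ℕ) : ℝ) ≤ (2 * B + 3) * 2 ^ K * g (K - k) := by
      intro k hk
      have hk' := (Finset.mem_range.1 hk).le
      have hkK : (k : ℝ) ≤ K := by exact_mod_cast hk'
      set x : ℝ := 2 ^ ((1 - τ) * ((K : ℝ) - k)) with hx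
      have hx1 : 1 ≤ x := Real.one_le_rpow (by norm_num)
        (mul_nonneg (by linarith) (by linarith))
      have hlog : Real.log (1 + 2 * Real.exp (B * 2 ^ (k + 1)) / x) ≤ 2 + 2 * B * 2 ^ k := by
        rw [Real.log_le_iff_le_exp (by positivity), Real.exp_add]
        have h1 : 1 ≤ Real.exp (B * 2 ^ (k + 1)) := Real.one_le_exp (by positivity)
        have h2 : 2 * Real.exp (B * 2 ^ (k + 1)) / x ≤ 2 * Real.exp (B * 2 ^ (k + 1)) :=
          div_le_self (by positivity) hx1
        have h3 := Real.add_one_le_exp (2 : ℝ)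
        have h4 : B * 2 ^ (k + 1) = 2 * B * 2 ^ k := by ring
        rw [← h4]
        nlinarith
      have e : x * 2 ^ k = 2 ^ K * g (K - k) := by
        simp only [g, hx]
        rw [← Real.rpow_natCast, ← Real.rpow_natCast, ← Real.rpow_add (by norm_num),
          ← Real.rpow_add (by norm_num), Nat.cast_sub hk']
        congr 1; ring
      have h2k : (1 : ℝ) ≤ 2 ^ k := one_le_pow₀ (by norm_num)
      calc _ ≤ x * (1 + (2 + 2 * B * 2 ^ k)) := by simp only [Nat.cast_zero, mul_zero, add_zero]
                                                   gcongr
        _ ≤ x * ((2 * B + 3) * 2 ^ k) := by gcongr; nlinarith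
        _ = (2 * B + 3) * (x * 2 ^ k) := by ring
        _ = _ := by rw [e]; ring
    refine (Finset.sum_le_sum this).trans ?_
    rw [← Finset.mul_sum]
    have h1 := sum_range_sub_le_tsum hg0 hg K
    calc _ ≤ (2 * B + 3) * 2 ^ K * ∑' j, g j := by gcongr
      _ ≤ _ := by nlinarith [pow_pos (two_pos : (0 : ℝ) < 2) K]

/-- Exponential growth of the nets with a mesh decaying faster than the critical rate. -/
lemma IsNetSeq.hasCover_of_exp_fast {A : Set X} {S : ℕ → Finset X} {B R u s C : ℝ} (hB : 1 ≤ B)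
    (hR : 0 < R) (hC : 0 < C) (hs0 : 0 < s) (hus : s < u) (hs1 : s ≤ 1) (hX : HullEntropy X s C)
    (hS : IsNetSeq A S (fun k => Real.exp (B * 2 ^ k)) (fun k => R * 2 ^ (-u * (k : ℝ)))) :
    ∃ C' > 0, ∃ L > 0, ∀ (y : ℝ) (k₀ : ℕ), 1 ≤ y → Real.exp (B * 2 ^ k₀) ≤ √y →
      HasCover (absConvexHull ℝ A) (C' * (y ^ (-s) * 2 ^ (-(u - s) * (k₀ : ℝ)))) (L * y) := by
  set τ := min 1 ((u - s) / 2) with hτ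
  have hτ0 : 0 < τ := lt_min one_pos (by linarith)
  have hτ1 : τ ≤ 1 := min_le_left _ _
  have hτ2 : τ ≤ (u - s) / 2 := min_le_right _ _
  have hγ : 0 < u - s - s * τ := by nlinarith
  set f : ℕ → ℝ := fun j => 2 ^ (-(u - s - s * τ) * (j : ℝ))
  set g : ℕ → ℝ := fun j => 2 ^ (-τ * (j : ℝ))
  set w : ℕ → ℝ := fun j => ((j : ℝ) + 1) ^ (2 * u) * (1 / 2) ^ j with hw
  have hf0 : ∀ j, 0 ≤ f j := fun j => by positivity
  have hg0 : ∀ j, 0 ≤ g j := fun j => by positivity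
  have hw0 : ∀ j, 0 ≤ w j := fun j => by positivity
  have hf : Summable f := summable_two_rpow hγ
  have hg : Summable g := summable_two_rpow hτ0
  have hwS : Summable w := summable_rpow_mul_geometric (by norm_num) (by norm_num)
  have hF0 : 0 ≤ ∑' j, f j := tsum_nonneg hf0
  have hG0 : 0 ≤ ∑' j, g j := tsum_nonneg hg0
  have hW0 : 0 ≤ ∑' j, w j := tsum_nonneg hw0
  refine ⟨C * R * (∑' j, f j) + C * R * (∑' j, w j) + 1, by positivity,
    (2 * B + 5) * (∑' j, g j) + 5, by positivity, fun y k₀ hy hk₀ => ?_⟩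
  have hy0 : 0 < y := by linarith
  have hsq1 : 1 ≤ √y := by rwa [Real.one_le_sqrt]
  have hsqy : √y * √y = y := Real.mul_self_sqrt hy0.le
  set S' : ℕ → Finset X := fun j => j.casesOn {0} fun i => S (k₀ + i)
  set N' : ℕ → ℝ := fun j => j.casesOn 1 fun i => Real.exp (B * 2 ^ (k₀ + i))
  set ε' : ℕ → ℝ := fun j => j.casesOn R fun i => R * 2 ^ (-u * ((k₀ + i : ℕ) : ℝ))
  set x : ℕ → ℝ := fun j => j.casesOn (√y) fun i => y * 2 ^ (-τ * (i : ℝ)) *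
    2 ^ (-((k₀ + i : ℕ) : ℝ))
  set l : ℕ → ℕ := fun j => j.casesOn ⌊√y⌋₊ fun i => 0
  have hS' : IsNetSeq A S' N' ε' := by
    refine ⟨rfl, ?_, ?_, ?_⟩
    · rintro (_ | i)
      · have := hS.subset 0
        rwa [hS.zero] at this
      · exact hS.subset (k₀ + i)
    · rintro (_ | i)
      · simp [S', N']
      · exact hS.card_le (k₀ + i)
    · rintro (_ | i)
      · have := hS.exists_norm_sub_le 0
        rw [hS.zero] at this
        simpa [S', ε'] using this
      · exact hS.exists_norm_sub_le (k₀ + i)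
  have hε' : ∀ k, 0 < ε' k := by rintro (_ | i) <;> simp only [ε'] <;> positivity
  have hx : ∀ k, 0 < x k := by rintro (_ | i) <;> simp only [x] <;> positivity
  have htarget : 0 < y ^ (-s) * (2 : ℝ) ^ (-(u - s) * (k₀ : ℝ)) := by positivity
  obtain ⟨J, hJ⟩ : ∃ J, ε' (J + 1) ≤ y ^ (-s) * (2 : ℝ) ^ (-(u - s) * (k₀ : ℝ)) := by
    have h1 : Filter.Tendsto (fun k : ℕ => R * (2 : ℝ) ^ (-u * (k : ℝ))) Filter.atTop
        (nhds (R * 0)) := (summable_two_rpow (hs0.trans hus)).tendsto_atTop_zero.const_mul R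
    rw [mul_zero] at h1
    obtain ⟨J, hJ⟩ := Filter.eventually_atTop.1 (h1.eventually_lt_const htarget)
    exact ⟨J, (hJ (k₀ + J) (by omega)).le⟩
  refine (hS'.hasCover hX hε' x hx l (J + 1)).mono le_rfl ?_ ?_
  · rw [Finset.sum_range_succ']
    have h0 : C * ε' 0 * x 0 ^ (-s) * (1 / 2) ^ l 0 ≤
        C * R * (∑' j, w j) * (y ^ (-s) * (2 : ℝ) ^ (-(u - s) * (k₀ : ℝ))) := by
      have h1 : (√y) ^ (-s) ≤ 1 := Real.rpow_le_one_of_one_le_of_nonpos hsq1 (by linarith)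
      have h2 : (1 / 2 : ℝ) ^ ⌊√y⌋₊ ≤ (∑' j, w j) * y ^ (-u) := by
        have h3 := hwS.le_tsum ⌊√y⌋₊ fun j _ => hw0 j
        have h4 : y ^ u ≤ ((⌊√y⌋₊ : ℝ) + 1) ^ (2 * u) := by
          have : y ^ u = √y ^ (2 * u) := by
            rw [Real.rpow_mul (Real.sqrt_nonneg y), Real.rpow_two, Real.sq_sqrt hy0.le]
          rw [this]
          exact Real.rpow_le_rpow (Real.sqrt_nonneg y) (Nat.lt_floor_add_one _).le
            (by linarith)
        rw [Real.rpow_neg hy0.le, ← div_eq_mul_inv, le_div_iff₀ (by positivity), mul_comm]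
        exact (mul_le_mul_of_nonneg_right h4 (by positivity)).trans h3
      have h5 : y ^ (-u) ≤ y ^ (-s) * (2 : ℝ) ^ (-(u - s) * (k₀ : ℝ)) := by
        have h6 : (2 : ℝ) ^ k₀ ≤ y := by
          have h7 := Real.add_one_le_exp (B * (2 : ℝ) ^ k₀)
          have h8 : (0 : ℝ) < 2 ^ k₀ := by positivity
          nlinarith
        have h9 : y ^ (-(u - s)) ≤ ((2 : ℝ) ^ k₀) ^ (-(u - s)) :=
          Real.rpow_le_rpow_of_nonpos (by positivity) h6 (by linarith)
        have e1 : ((2 : ℝ) ^ k₀) ^ (-(u - s)) = 2 ^ (-(u - s) * (k₀ : ℝ)) := by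
          rw [mul_comm, Real.rpow_mul (by norm_num), Real.rpow_natCast]
        have e2 : y ^ (-u) = y ^ (-s) * y ^ (-(u - s)) := by
          rw [← Real.rpow_add hy0]; congr 1; ring
        rw [e2, ← e1]
        gcongr
      calc C * ε' 0 * x 0 ^ (-s) * (1 / 2) ^ l 0 = C * R * √y ^ (-s) * (1 / 2) ^ ⌊√y⌋₊ := rfl
        _ ≤ C * R * 1 * ((∑' j, w j) * y ^ (-u)) := by gcongr
        _ = C * R * (∑' j, w j) * y ^ (-u) := by ring
        _ ≤ _ := by gcongr
    have h1 : ∀ j ∈ Finset.range J, C * ε' (j + 1) * x (j + 1) ^ (-s) * (1 / 2) ^ l (j + 1) =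
        C * R * (y ^ (-s) * (2 : ℝ) ^ (-(u - s) * (k₀ : ℝ))) * f j := by
      intro j _
      simp only [ε', x, l, f, pow_zero, mul_one]
      rw [Real.mul_rpow (by positivity) (by positivity), Real.mul_rpow (by positivity)
        (by positivity), ← Real.rpow_mul (by norm_num), ← Real.rpow_mul (by norm_num)]
      have e : (2 : ℝ) ^ (-u * ((k₀ + j : ℕ) : ℝ)) * 2 ^ (-τ * (j : ℝ) * -s) *
          2 ^ (-((k₀ + j : ℕ) : ℝ) * -s) = 2 ^ (-(u - s) * (k₀ : ℝ)) *
          2 ^ (-(u - s - s * τ) * (j : ℝ)) := by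
        simp only [← Real.rpow_add (by norm_num : (0 : ℝ) < 2)]
        congr 1; push_cast; ring
      linear_combination C * R * y ^ (-s) * e
    rw [Finset.sum_congr rfl h1, ← Finset.mul_sum]
    have h2 := hf.sum_le_tsum (Finset.range J) fun j _ => hf0 j
    have h3 : C * R * (y ^ (-s) * (2 : ℝ) ^ (-(u - s) * (k₀ : ℝ))) * ∑ j ∈ Finset.range J, f j ≤
        C * R * (y ^ (-s) * (2 : ℝ) ^ (-(u - s) * (k₀ : ℝ))) * ∑' j, f j := by gcongr
    linarith
  · rw [Finset.sum_range_succ']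
    have h0 : x 0 * (1 + Real.log (1 + 2 * N' (0 + 1) / x 0)) + 2 * N' (0 + 1) * l 0 ≤ 5 * y := by
      change √y * (1 + Real.log (1 + 2 * Real.exp (B * 2 ^ k₀) / √y)) +
        2 * Real.exp (B * 2 ^ k₀) * (⌊√y⌋₊ : ℝ) ≤ 5 * y
      have h1 : (⌊√y⌋₊ : ℝ) ≤ √y := Nat.floor_le (Real.sqrt_nonneg y)
      have h2 : 2 * Real.exp (B * 2 ^ k₀) / √y ≤ 2 := by
        rw [div_le_iff₀ (by positivity)]; linarith
      have h3 : Real.log (1 + 2 * Real.exp (B * 2 ^ k₀) / √y) ≤ 2 := by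
        rw [Real.log_le_iff_le_exp (by positivity)]
        linarith [Real.add_one_le_exp (2 : ℝ)]
      have h4 : Real.exp (B * 2 ^ k₀) * (⌊√y⌋₊ : ℝ) ≤ √y * √y := by gcongr
      nlinarith
    have h1 : ∀ j ∈ Finset.range J, x (j + 1) *
        (1 + Real.log (1 + 2 * N' (j + 1 + 1) / x (j + 1))) +
        2 * N' (j + 1 + 1) * l (j + 1) ≤ (2 * B + 5) * y * g j := by
      intro j _
      change x (j + 1) * (1 + Real.log (1 + 2 * Real.exp (B * 2 ^ (k₀ + (j + 1))) / x (j + 1))) +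
        2 * Real.exp (B * 2 ^ (k₀ + (j + 1))) * ((0 : ℕ) : ℝ) ≤ (2 * B + 5) * y * g j
      have hxj : x (j + 1) = y * 2 ^ (-τ * (j : ℝ)) * 2 ^ (-((k₀ + j : ℕ) : ℝ)) := rfl
      have hxp := hx (j + 1)
      set z := x (j + 1)
      have hz : z * 2 ^ (k₀ + j) = y * g j := by
        rw [hxj, mul_assoc, ← Real.rpow_natCast, ← Real.rpow_add (by norm_num)]
        simp [g]
      have h2k : (1 : ℝ) ≤ 2 ^ (k₀ + j) := one_le_pow₀ (by norm_num)
      have hzinv : 1 / z ≤ Real.exp (2 * 2 ^ (k₀ + j)) := by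
        have h1 : (2 : ℝ) ^ (-(2 * ((k₀ + j : ℕ) : ℝ))) ≤ z := by
          calc _ ≤ (2 : ℝ) ^ (-τ * (j : ℝ) + -((k₀ + j : ℕ) : ℝ)) := by
                apply Real.rpow_le_rpow_of_exponent_le (by norm_num)
                push_cast
                nlinarith [j.cast_nonneg (α := ℝ), k₀.cast_nonneg (α := ℝ)]
            _ = 1 * 2 ^ (-τ * (j : ℝ)) * 2 ^ (-((k₀ + j : ℕ) : ℝ)) := by
                rw [Real.rpow_add (by norm_num), one_mul]
            _ ≤ z := by rw [hxj]; gcongr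
        have h2 : 1 / z ≤ 2 ^ (2 * ((k₀ + j : ℕ) : ℝ)) := by
          rw [div_le_iff₀ hxp]
          calc (1 : ℝ) = 2 ^ (2 * ((k₀ + j : ℕ) : ℝ)) * 2 ^ (-(2 * ((k₀ + j : ℕ) : ℝ))) := by
                rw [← Real.rpow_add (by norm_num)]; simp
            _ ≤ _ := by gcongr
        refine h2.trans ?_
        have e : (2 : ℝ) ^ (2 * ((k₀ + j : ℕ) : ℝ)) = (2 ^ (k₀ + j)) ^ 2 := by
          rw [mul_comm, Real.rpow_mul (by norm_num), Real.rpow_natCast, Real.rpow_two]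
        rw [e, two_mul, Real.exp_add, ← sq]
        have := Real.add_one_le_exp ((2 : ℝ) ^ (k₀ + j))
        gcongr
        linarith
      have hlog : Real.log (1 + 2 * Real.exp (B * 2 ^ (k₀ + (j + 1))) / z) ≤
          2 + (2 * B + 2) * 2 ^ (k₀ + j) := by
        rw [Real.log_le_iff_le_exp (by positivity), Real.exp_add]
        have e1 : Real.exp ((2 * B + 2) * 2 ^ (k₀ + j)) =
            Real.exp (B * 2 ^ (k₀ + (j + 1))) * Real.exp (2 * 2 ^ (k₀ + j)) := by
          rw [← Real.exp_add]; congr 1; ring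
        have h1 : 1 ≤ Real.exp ((2 * B + 2) * 2 ^ (k₀ + j)) := Real.one_le_exp (by positivity)
        have h2 : 2 * Real.exp (B * 2 ^ (k₀ + (j + 1))) / z ≤
            2 * Real.exp ((2 * B + 2) * 2 ^ (k₀ + j)) := by
          rw [e1, ← mul_one_div, mul_assoc]
          gcongr
        have h3 := Real.add_one_le_exp (2 : ℝ)
        nlinarith
      calc _ ≤ z * (1 + (2 + (2 * B + 2) * 2 ^ (k₀ + j))) := by
            simp only [Nat.cast_zero, mul_zero, add_zero]
            gcongr
        _ ≤ z * ((2 * B + 5) * 2 ^ (k₀ + j)) := by gcongr; nlinarith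
        _ = (2 * B + 5) * (z * 2 ^ (k₀ + j)) := by ring
        _ = _ := by rw [hz]; ring
    have h2 := hg.sum_le_tsum (Finset.range J) fun j _ => hg0 j
    have h3 := Finset.sum_le_sum h1
    rw [← Finset.mul_sum] at h3
    have h4 : (2 * B + 5) * y * ∑ j ∈ Finset.range J, g j ≤ (2 * B + 5) * y * ∑' j, g j := by
      gcongr
    linarith

/-- Polynomial growth of the nets, up to logarithmic factors. -/
lemma IsNetSeq.hasCover_of_poly {A : Set X} {S : ℕ → Finset X} {B R u s β C : ℝ} (hB : 1 ≤ B)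
    (hR : 0 < R) (hC : 0 < C) (hu : 0 < u) (hβ : 0 ≤ β) (hX : HullEntropy X s C)
    (hS : IsNetSeq A S (fun k => B * 2 ^ k)
      (fun k => R * (2 ^ (-u * (k : ℝ)) * ((k : ℝ) + 1) ^ β))) :
    ∃ C' > 0, ∃ L > 0, ∀ m : ℕ, HasCover (absConvexHull ℝ A)
      (C' * (2 ^ (-(u + s) * (m : ℝ)) * ((m : ℝ) + 1) ^ β)) (L * 2 ^ m) := by
  obtain ⟨M, hM⟩ := exists_nat_ge (u + s + 1)
  set c₁ := 1 + Real.log (1 + 4 * B) with hc₁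
  have hlogB : 0 ≤ Real.log (5 * B) := Real.log_nonneg (by linarith)
  have hc₁0 : 0 ≤ c₁ := add_nonneg zero_le_one (Real.log_nonneg (by linarith))
  set f : ℕ → ℝ := fun j => (1 / 2) ^ j
  set g : ℕ → ℝ := fun j => (c₁ + 4 * B * M) * (((j : ℝ) + 1) ^ (1 : ℝ) * (1 / 2) ^ j)
  set v : ℕ → ℝ := fun j => ((j : ℝ) + 1) ^ (β + 3 * s) * ((2 : ℝ) ^ (-u)) ^ j
  set w : ℕ → ℝ := fun j => (5 + Real.log (5 * B)) * ((((j + 1 : ℕ) : ℝ)) ^ 2)⁻¹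
  have hf0 : ∀ j, 0 ≤ f j := fun j => by positivity
  have hg0 : ∀ j, 0 ≤ g j := fun j => by positivity
  have hv0 : ∀ j, 0 ≤ v j := fun j => by positivity
  have hw0 : ∀ j, 0 ≤ w j := fun j => by positivity
  have hf : Summable f := summable_geometric_of_lt_one (by norm_num) (by norm_num)
  have hg : Summable g := (summable_rpow_mul_geometric (by norm_num) (by norm_num)).mul_left _
  have hv : Summable v :=
    summable_rpow_mul_geometric (two_rpow_neg_mem hu).1 (two_rpow_neg_mem hu).2
  have hw : Summable w := ((summable_nat_add_iff (f := fun j : ℕ => ((j : ℝ) ^ 2)⁻¹) 1).2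
    (Real.summable_nat_pow_inv.2 (by norm_num))).mul_left _
  have hF0 : 0 ≤ ∑' j, f j := tsum_nonneg hf0
  have hG0 : 0 ≤ ∑' j, g j := tsum_nonneg hg0
  have hV0 : 0 ≤ ∑' j, v j := tsum_nonneg hv0
  have hW0 : 0 ≤ ∑' j, w j := tsum_nonneg hw0
  refine ⟨C * R * (∑' j, f j) + C * R * (∑' j, v j) + 1, by positivity,
    (∑' j, g j) + (∑' j, w j) + 1, by positivity, fun m => ?_⟩
  set ε : ℕ → ℝ := fun k => R * (2 ^ (-u * (k : ℝ)) * ((k : ℝ) + 1) ^ β) with hε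
  set t : ℝ := 2 ^ (-(u + s) * (m : ℝ)) * ((m : ℝ) + 1) ^ β with ht
  have ht0 : 0 < t := by positivity
  obtain ⟨J, hJ⟩ : ∃ J, ε (m + J) ≤ t := by
    have h1 : Filter.Tendsto ε Filter.atTop (nhds (R * 0)) := by
      refine Filter.Tendsto.const_mul R ?_
      simp only [two_rpow_mul_natCast, mul_comm (((2 : ℝ) ^ (-u)) ^ _)]
      exact (summable_rpow_mul_geometric (two_rpow_neg_mem hu).1
        (two_rpow_neg_mem hu).2).tendsto_atTop_zero
    rw [mul_zero] at h1
    obtain ⟨J, hJ⟩ := Filter.eventually_atTop.1 (h1.eventually_lt_const ht0)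
    exact ⟨J, (hJ (m + J) (by omega)).le⟩
  set x : ℕ → ℝ := fun k => if k < m then 2 ^ k else 2 ^ m / ((k - m : ℕ) + 1 : ℝ) ^ 3 with hx
  set l : ℕ → ℕ := fun k => M * (m - k)
  have hx0 : ∀ k, 0 < x k := by
    intro k
    simp only [hx]
    split_ifs <;> positivity
  refine (hS.hasCover hX (fun k => by positivity) x hx0 l (m + J)).mono le_rfl ?_ ?_
  · rw [Finset.sum_range_add]
    have h1 : ∀ k ∈ Finset.range m, C * ε k * x k ^ (-s) * (1 / 2) ^ l k ≤
        C * R * t * f (m - k) := by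
      intro k hk
      have hk' := Finset.mem_range.1 hk
      have hkm : (k : ℝ) ≤ m := by exact_mod_cast hk'.le
      have e : (2 : ℝ) ^ (-u * (k : ℝ)) * ((2 : ℝ) ^ k) ^ (-s) * (1 / 2) ^ (M * (m - k)) ≤
          2 ^ (-(u + s) * (m : ℝ)) * (1 / 2) ^ (m - k) := by
        have e1 : ∀ i : ℕ, (1 / 2 : ℝ) ^ i = 2 ^ (-(i : ℝ)) := fun i => by
          rw [Real.rpow_neg (by norm_num), Real.rpow_natCast]; simp
        rw [e1, e1, ← Real.rpow_natCast 2 k, ← Real.rpow_mul (by norm_num),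
          ← Real.rpow_add (by norm_num), ← Real.rpow_add (by norm_num),
          ← Real.rpow_add (by norm_num)]
        apply Real.rpow_le_rpow_of_exponent_le (by norm_num)
        rw [Nat.cast_mul, Nat.cast_sub hk'.le]
        nlinarith
      have e2 : ((k : ℝ) + 1) ^ β ≤ ((m : ℝ) + 1) ^ β := by gcongr
      calc C * ε k * x k ^ (-s) * (1 / 2) ^ l k
          = C * R * ((2 : ℝ) ^ (-u * (k : ℝ)) * ((2 : ℝ) ^ k) ^ (-s) * (1 / 2) ^ (M * (m - k)))
            * ((k : ℝ) + 1) ^ β := by simp only [hε, hx, hk', if_true, l]; ring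
        _ ≤ C * R * (2 ^ (-(u + s) * (m : ℝ)) * (1 / 2) ^ (m - k)) * ((m : ℝ) + 1) ^ β := by
            gcongr
        _ = _ := by simp only [ht, f]; ring
    have h2 : ∀ j ∈ Finset.range J, C * ε (m + j) * x (m + j) ^ (-s) * (1 / 2) ^ l (m + j) ≤
        C * R * t * v j := by
      intro j _
      have e1 : (((m + j : ℕ) : ℝ) + 1) ^ β ≤ ((m : ℝ) + 1) ^ β * ((j : ℝ) + 1) ^ β := by
        rw [← Real.mul_rpow (by positivity) (by positivity)]
        apply Real.rpow_le_rpow (by positivity) _ hβ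
        push_cast
        nlinarith [mul_nonneg (m.cast_nonneg (α := ℝ)) (j.cast_nonneg (α := ℝ))]
      have e2 : x (m + j) ^ (-s) = 2 ^ (-s * (m : ℝ)) * ((j : ℝ) + 1) ^ (3 * s) := by
        have : x (m + j) = 2 ^ m / ((j : ℝ) + 1) ^ 3 := by simp [hx]
        rw [this, Real.div_rpow (by positivity) (by positivity), ← Real.rpow_natCast,
          ← Real.rpow_natCast, ← Real.rpow_mul (by norm_num), ← Real.rpow_mul (by positivity),
          mul_comm (m : ℝ), div_eq_mul_inv, ← Real.rpow_neg (by positivity)]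
        congr 2
        push_cast; ring
      have e3 : (2 : ℝ) ^ (-u * ((m + j : ℕ) : ℝ)) * 2 ^ (-s * (m : ℝ)) =
          2 ^ (-(u + s) * (m : ℝ)) * ((2 : ℝ) ^ (-u)) ^ j := by
        rw [← two_rpow_mul_natCast, ← Real.rpow_add (by norm_num), ← Real.rpow_add (by norm_num)]
        congr 1; push_cast; ring
      have e4 : ((j : ℝ) + 1) ^ (β + 3 * s) = ((j : ℝ) + 1) ^ β * ((j : ℝ) + 1) ^ (3 * s) :=
        Real.rpow_add (by positivity) _ _
      have e5 : l (m + j) = 0 := by simp [l]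
      rw [e5, pow_zero, mul_one, e2]
      calc C * ε (m + j) * (2 ^ (-s * (m : ℝ)) * ((j : ℝ) + 1) ^ (3 * s))
          = C * R * ((2 : ℝ) ^ (-u * ((m + j : ℕ) : ℝ)) * 2 ^ (-s * (m : ℝ))) *
            (((m + j : ℕ) : ℝ) + 1) ^ β * ((j : ℝ) + 1) ^ (3 * s) := by simp only [hε]; ring
        _ ≤ C * R * ((2 : ℝ) ^ (-u * ((m + j : ℕ) : ℝ)) * 2 ^ (-s * (m : ℝ))) *
            (((m : ℝ) + 1) ^ β * ((j : ℝ) + 1) ^ β) * ((j : ℝ) + 1) ^ (3 * s) := by gcongr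
        _ = _ := by rw [e3]; simp only [ht, v, e4]; ring
    have h3 := Finset.sum_le_sum h1
    have h4 := Finset.sum_le_sum h2
    rw [← Finset.mul_sum] at h3 h4
    have h5 : C * R * t * ∑ k ∈ Finset.range m, f (m - k) ≤ C * R * t * ∑' j, f j := by
      gcongr; exact sum_range_sub_le_tsum hf0 hf m
    have h6 : C * R * t * ∑ j ∈ Finset.range J, v j ≤ C * R * t * ∑' j, v j := by
      gcongr; exact hv.sum_le_tsum _ fun j _ => hv0 j
    linarith
  · rw [Finset.sum_range_add]
    have h1 : ∀ k ∈ Finset.range m, x k * (1 + Real.log (1 + 2 * (B * 2 ^ (k + 1)) / x k)) +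
        2 * (B * 2 ^ (k + 1)) * l k ≤ 2 ^ m * g (m - k) := by
      intro k hk
      have hk' := Finset.mem_range.1 hk
      have hxk : x k = 2 ^ k := by simp [hx, hk']
      have e1 : 1 + 2 * (B * 2 ^ (k + 1)) / (2 : ℝ) ^ k = 1 + 4 * B := by
        rw [pow_succ]; field_simp; ring
      have e2 : (2 : ℝ) ^ m = 2 ^ k * 2 ^ (m - k) := by rw [← pow_add]; congr 1; omega
      have e3 : (2 : ℝ) ^ m * (1 / 2) ^ (m - k) = 2 ^ k := by
        rw [e2, mul_assoc, ← mul_pow]; norm_num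
      have e4 : (l k : ℝ) = M * ((m - k : ℕ) : ℝ) := by simp [l]
      rw [hxk, e1, e4]
      simp only [g, Real.rpow_one]
      set i : ℝ := ((m - k : ℕ) : ℝ)
      have hi : 0 ≤ i := Nat.cast_nonneg _
      calc 2 ^ k * (1 + Real.log (1 + 4 * B)) + 2 * (B * 2 ^ (k + 1)) * (M * i)
          = 2 ^ k * (c₁ + 4 * B * M * i) := by rw [pow_succ]; ring
        _ ≤ 2 ^ k * ((c₁ + 4 * B * M) * (i + 1)) := by
            gcongr
            have : 0 ≤ c₁ * i := by positivity
            have : 0 ≤ 4 * B * M := by positivity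
            nlinarith
        _ = _ := by rw [← e3]; ring
    have h2 : ∀ j ∈ Finset.range J, x (m + j) *
        (1 + Real.log (1 + 2 * (B * 2 ^ (m + j + 1)) / x (m + j))) +
        2 * (B * 2 ^ (m + j + 1)) * l (m + j) ≤ 2 ^ m * w j := by
      intro j _
      have hxj : x (m + j) = 2 ^ m / ((j : ℝ) + 1) ^ 3 := by simp [hx]
      have e5 : l (m + j) = 0 := by simp [l]
      have hj1 : (1 : ℝ) ≤ (j : ℝ) + 1 := by linarith [j.cast_nonneg (α := ℝ)]
      have e1 : 1 + 2 * (B * 2 ^ (m + j + 1)) / (2 ^ m / ((j : ℝ) + 1) ^ 3) =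
          1 + 4 * B * (2 ^ j * ((j : ℝ) + 1) ^ 3) := by
        rw [pow_succ, pow_add]; field_simp; ring
      have hlog : Real.log (1 + 4 * B * (2 ^ j * ((j : ℝ) + 1) ^ 3)) ≤
          Real.log (5 * B) + 4 * ((j : ℝ) + 1) - 1 := by
        have h1 : 1 + 4 * B * (2 ^ j * ((j : ℝ) + 1) ^ 3) ≤
            5 * B * (2 ^ j * ((j : ℝ) + 1) ^ 3) := by
          have : 1 ≤ (2 : ℝ) ^ j * ((j : ℝ) + 1) ^ 3 :=
            one_le_mul_of_one_le_of_one_le (one_le_pow₀ (by norm_num)) (one_le_pow₀ hj1)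
          nlinarith
        refine (Real.log_le_log (by positivity) h1).trans ?_
        rw [Real.log_mul (by positivity) (by positivity),
          Real.log_mul (x := (2 : ℝ) ^ j) (by positivity) (by positivity), Real.log_pow, Real.log_pow]
        have h2 := Real.log_le_sub_one_of_pos (by positivity : (0 : ℝ) < (j : ℝ) + 1)
        have h3 := Real.log_le_sub_one_of_pos (by norm_num : (0 : ℝ) < 2)
        push_cast
        nlinarith [j.cast_nonneg (α := ℝ)]
      rw [hxj, e5, e1]
      calc 2 ^ m / ((j : ℝ) + 1) ^ 3 * (1 + Real.log (1 + 4 * B * (2 ^ j * ((j : ℝ) + 1) ^ 3))) +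
            2 * (B * 2 ^ (m + j + 1)) * ((0 : ℕ) : ℝ)
          ≤ 2 ^ m / ((j : ℝ) + 1) ^ 3 * ((5 + Real.log (5 * B)) * ((j : ℝ) + 1)) := by
            simp only [Nat.cast_zero, mul_zero, add_zero]
            gcongr
            nlinarith
        _ = _ := by simp only [w]; push_cast; field_simp
    have h3 := Finset.sum_le_sum h1
    have h4 := Finset.sum_le_sum h2
    rw [← Finset.mul_sum] at h3 h4
    have h5 : 2 ^ m * ∑ k ∈ Finset.range m, g (m - k) ≤ 2 ^ m * ∑' j, g j := by
      gcongr; exact sum_range_sub_le_tsum hg0 hg m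
    have h6 : 2 ^ m * ∑ j ∈ Finset.range J, w j ≤ 2 ^ m * ∑' j, w j := by
      gcongr; exact hw.sum_le_tsum _ fun j _ => hw0 j
    have h7 : (0 : ℝ) < 2 ^ m := by positivity
    linarith

end Rates

section Entropy

open scoped Pointwise in
lemma sum_smul_mem_absConvexHull {X ι : Type*} [NormedAddCommGroup X] [NormedSpace ℝ X] {A : Set X}
    {v : ι → X} (hv : ∀ i, v i ∈ A) (hA : A.Nonempty) (x : ι → ℝ) (G : Finset ι)
    (hx : ∑ i ∈ G, |x i| ≤ 1) : ∑ i ∈ G, x i • v i ∈ absConvexHull ℝ A := by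
  classical
  have hbal : Balanced ℝ (absConvexHull ℝ A) := balanced_absConvexHull
  have hconv : Convex ℝ (absConvexHull ℝ A) := convex_absConvexHull
  have hne : (absConvexHull ℝ A).Nonempty := hA.mono subset_absConvexHull
  have key : ∑ i ∈ G, x i • v i ∈ (∑ i ∈ G, |x i|) • absConvexHull ℝ A := by
    clear hx
    induction G using Finset.induction_on with
    | empty => simp [Set.zero_smul_set hne]
    | insert i G hi ih =>
      rw [Finset.sum_insert hi, Finset.sum_insert hi,
        hconv.add_smul (abs_nonneg _) (Finset.sum_nonneg fun _ _ => abs_nonneg _)]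
      refine Set.add_mem_add ?_ ih
      have hvi : v i ∈ absConvexHull ℝ A := subset_absConvexHull (hv i)
      rcases abs_cases (x i) with ⟨h, _⟩ | ⟨h, _⟩
      · rw [h]; exact Set.smul_mem_smul_set hvi
      · rw [h]
        have : x i • v i = (-x i) • (-v i) := by simp
        rw [this]
        exact Set.smul_mem_smul_set (hbal.neg_mem_iff.2 hvi)
  refine hbal _ ?_ key
  rwa [Real.norm_of_nonneg (Finset.sum_nonneg fun _ _ => abs_nonneg _)]

lemma map_mem_closure_absConvexHull {T Y : Type} [DecidableEq T] [NormedAddCommGroup Y]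
    [NormedSpace ℝ Y] (W : ellOne T →L[ℝ] Y) {A : Set Y} (h0 : (0 : Y) ∈ A)
    (hA : ∀ t, W (lp.single 1 t 1) ∈ A) {x : ellOne T} (hx : ‖x‖ ≤ 1) :
    W x ∈ closure (absConvexHull ℝ A) := by
  have h := (lp.hasSum_single (p := 1) ENNReal.one_ne_top x).mapL W
  refine mem_closure_of_tendsto h (Filter.Eventually.of_forall fun G => ?_)
  have e : ∀ t, W (lp.single 1 t (x t)) = x t • W (lp.single 1 t 1) := fun t => by
    rw [← map_smul, ← lp.single_smul, smul_eq_mul, mul_one]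
  simp only [e]
  refine sum_smul_mem_absConvexHull hA ⟨0, h0⟩ _ G ?_
  have := lp.sum_rpow_le_norm_rpow (p := 1) (by simp) x G
  simp only [ENNReal.toReal_one, Real.rpow_one, Real.norm_eq_abs] at this
  exact this.trans hx

lemma entropyNumber_le_of_hasCover {T Y : Type} [DecidableEq T] [NormedAddCommGroup Y]
    [NormedSpace ℝ Y] (W : ellOne T →L[ℝ] Y) {A : Set Y} (h0 : (0 : Y) ∈ A)
    (hA : ∀ t, W (lp.single 1 t 1) ∈ A) {r L : ℝ} {n : ℕ}
    (h : HasCover (absConvexHull ℝ A) r L) (hL : L ≤ ((n - 1 : ℕ) : ℝ) * Real.log 2) :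
    entropyNumber n W ≤ r := by
  obtain ⟨F, hF, hcov⟩ := h
  have hr : 0 ≤ r := by
    obtain ⟨y, -, hy⟩ := hcov 0 (subset_absConvexHull h0)
    exact (norm_nonneg _).trans hy
  refine le_of_forall_pos_le_add fun δ hδ => csInf_le ⟨0, fun ε hε => hε.1.le⟩
    ⟨by linarith, F, ?_, fun x hx => ?_⟩
  · have h2 : Real.exp L ≤ 2 ^ (n - 1) := by
      refine (Real.exp_le_exp.2 hL).trans ?_
      rw [← Real.log_pow, Real.exp_log (by positivity)]
    exact_mod_cast hF.trans h2
  · obtain ⟨z, hz, hxz⟩ := Metric.mem_closure_iff.1 (map_mem_closure_absConvexHull W h0 hA hx) δ hδ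
    obtain ⟨y, hy, hzy⟩ := hcov z hz
    refine ⟨y, hy, ?_⟩
    rw [dist_eq_norm] at hxz
    calc ‖W x - y‖ ≤ ‖W x - z‖ + ‖z - y‖ := norm_sub_le_norm_sub_add_norm_sub _ _ _
      _ < r + δ := by linarith

lemma exists_forall_two_le {e f : ℕ → ℝ} (hf : ∀ n, 2 ≤ n → 0 < f n)
    (h : ∃ C > 0, ∃ n₀, ∀ n ≥ n₀, 2 ≤ n → e n ≤ C * f n) :
    ∃ C > 0, ∀ n, 2 ≤ n → e n ≤ C * f n := by
  obtain ⟨C, hC, n₀, h⟩ := h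
  have hsum : 0 ≤ ∑ k ∈ Finset.range n₀, |e k / f k| := Finset.sum_nonneg fun _ _ => abs_nonneg _
  refine ⟨C + ∑ k ∈ Finset.range n₀, |e k / f k|, by positivity, fun n hn => ?_⟩
  have hfn := hf n hn
  by_cases hnn : n₀ ≤ n
  · exact (h n hnn hn).trans (by gcongr; linarith)
  · rw [← div_le_iff₀ hfn]
    have := Finset.single_le_sum (f := fun k => |e k / f k|) (fun _ _ => abs_nonneg _)
      (Finset.mem_range.2 (not_le.1 hnn))
    exact (le_abs_self _).trans (by linarith)

end Entropy

section Tree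
variable {T : Type} [PartialOrder T] [OrderBot T] {q : ℝ} {α σ : T → ℝ}

lemma norm_le_dOrd (htree : IsTree T) (hq : 0 < q) [Fact (1 ≤ ENNReal.ofReal q)]
    (hα : ∀ t, 0 < α t) (hσ : ∀ t, 0 < σ t) {s t : T} (hst : s < t) (f : ellQ T q)
    (hf : ∀ r ∈ Set.Ioc s t, |f r| ≤ σ t * α r) (hf0 : ∀ r ∉ Set.Ioc s t, f r = 0) :
    ‖f‖ ≤ dOrd q α σ s t := by
  have hfin : (Set.Ioc s t).Finite := (htree.1 t).subset fun r hr => hr.2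
  have h1 : ‖f‖ ≤ (∑ᶠ r ∈ Set.Ioc s t, α r ^ q) ^ (1 / q) * σ t := by
    rw [finsum_mem_eq_finite_toFinset_sum _ hfin]
    have hsum0 : 0 ≤ ∑ r ∈ hfin.toFinset, α r ^ q :=
      Finset.sum_nonneg fun r _ => Real.rpow_nonneg (hα r).le q
    have hn : ‖f‖ ^ q ≤ (∑ r ∈ hfin.toFinset, α r ^ q) * σ t ^ q := by
      have e : ‖f‖ ^ q = ∑ r ∈ hfin.toFinset, |f r| ^ q :=
        (lp_norm_rpow hq f).unique (hasSum_sum_of_ne_finset_zero fun r hr => by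
          rw [hf0 r (by simpa using hr), abs_zero, Real.zero_rpow hq.ne'])
      rw [e, Finset.sum_mul]
      refine Finset.sum_le_sum fun r hr => ?_
      rw [← Real.mul_rpow (hα r).le (hσ t).le, mul_comm (α r)]
      exact Real.rpow_le_rpow (abs_nonneg _) (hf r (by simpa using hr)) hq.le
    rw [← Real.rpow_le_rpow_iff (norm_nonneg f)
      (mul_nonneg (Real.rpow_nonneg hsum0 _) (hσ t).le) hq,
      Real.mul_rpow (Real.rpow_nonneg hsum0 _) (hσ t).le, ← Real.rpow_mul hsum0,
      one_div_mul_cancel hq.ne', Real.rpow_one]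
    exact hn
  exact h1.trans (le_csSup (hfin.image _).bddAbove
    (Set.mem_image_of_mem (fun v => (∑ᶠ r ∈ Set.Ioc s v, α r ^ q) ^ (1 / q) * σ v) ⟨hst, le_rfl⟩))

open Classical in
/-- Along a branch, the image of a unit vector is close to the image of its ancestor or to `0`. -/
lemma exists_norm_sub_le_dOrd (htree : IsTree T) (hq : 0 < q) [Fact (1 ≤ ENNReal.ofReal q)]
    (hα : ∀ t, 0 < α t) (hσ : ∀ t, 0 < σ t) (hmono : ∀ ⦃t s : T⦄, t ≤ s → σ s ≤ σ t)
    {v : T → ellQ T q}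
    (hv : ∀ t r, (v t : ∀ _ : T, ℝ) r = if r ≤ t ∧ σ r = σ t then σ t * α r else 0)
    {s t : T} (hst : s < t) :
    ‖v t - v s‖ ≤ dOrd q α σ s t ∨ ‖v t - 0‖ ≤ dOrd q α σ s t := by
  have hpos : ∀ r, |σ t * α r| = σ t * α r := fun r => abs_of_pos (mul_pos (hσ t) (hα r))
  by_cases hσst : σ s = σ t
  · left
    have e : ∀ r, (v t - v s : ellQ T q) r = v t r - v s r := fun r => rfl
    refine norm_le_dOrd htree hq hα hσ hst _ (fun r hr => ?_) fun r hr => ?_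
    · have hrs : ¬ r ≤ s := not_le_of_gt hr.1
      rw [e, hv t, hv s, if_neg (c := r ≤ s ∧ σ r = σ s) (fun h => hrs h.1), sub_zero]
      split_ifs
      · exact (hpos r).le
      · simpa using (mul_pos (hσ t) (hα r)).le
    · rw [e, hv, hv, hσst]
      by_cases hrt : r ≤ t
      · have hrs : r ≤ s := by
          rcases htree.2.1 t r s hrt hst.le with h | h
          · exact h
          · by_contra hrs
            exact hr ⟨lt_of_le_of_ne h (fun h' => hrs h'.ge), hrt⟩
        simp [hrt, hrs]
      · have hrs : ¬ r ≤ s := fun h => hrt (h.trans hst.le)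
        simp [hrt, hrs]
  · right
    rw [sub_zero]
    refine norm_le_dOrd htree hq hα hσ hst _ (fun r hr => ?_) fun r hr => ?_
    · rw [hv]
      split_ifs
      · exact (hpos r).le
      · simpa using (mul_pos (hσ t) (hα r)).le
    · rw [hv, if_neg]
      rintro ⟨hrt, hrσ⟩
      rcases htree.2.1 t r s hrt hst.le with h | h
      · exact hσst (le_antisymm ((hmono h).trans hrσ.le) (hmono hst.le))
      · refine hr ⟨lt_of_le_of_ne h fun h' => hσst ?_, hrt⟩
        rw [h', hrσ]

open Classical in
lemma exists_net_of_orderCoveringNumber_le (htree : IsTree T) (hq : 0 < q)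
    [Fact (1 ≤ ENNReal.ofReal q)]
    (hα : ∀ t, 0 < α t) (hσ : ∀ t, 0 < σ t) (hmono : ∀ ⦃t s : T⦄, t ≤ s → σ s ≤ σ t)
    {v : T → ellQ T q}
    (hv : ∀ t r, (v t : ∀ _ : T, ℝ) r = if r ≤ t ∧ σ r = σ t then σ t * α r else 0)
    (glb : T → T → T) {ε M : ℝ} (hε : 0 < ε) (hM : 0 ≤ M)
    (h : orderCoveringNumber (treeDist q α σ glb) ε ≤ ENNReal.ofReal M) :
    ∃ F : Finset (ellQ T q), (F : Set (ellQ T q)) ⊆ insert 0 (Set.range v) ∧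
      (F.card : ℝ) ≤ M + 2 ∧ ∀ a ∈ insert 0 (Set.range v), ∃ y ∈ F, ‖a - y‖ ≤ ε := by
  have hlt : orderCoveringNumber (treeDist q α σ glb) ε < ENNReal.ofReal (M + 1) :=
    h.trans_lt (ENNReal.ofReal_lt_ofReal_iff (by positivity) |>.2 (by linarith))
  obtain ⟨S, hS⟩ := iInf_lt_iff.1 hlt
  obtain ⟨hnet, hS⟩ := iInf_lt_iff.1 hS
  have hcard : (S.card : ℝ) ≤ M + 1 := by
    rw [← ENNReal.ofReal_natCast, ENNReal.ofReal_lt_ofReal_iff (by positivity)] at hS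
    exact hS.le
  refine ⟨insert 0 (S.image v), ?_, ?_, ?_⟩
  · intro y hy
    simp only [Finset.coe_insert, Finset.coe_image] at hy
    exact Set.insert_subset_insert (Set.image_subset_range _ _) hy
  · have h1 : ((insert 0 (S.image v)).card : ℝ) ≤ (S.card : ℝ) + 1 := by
      exact_mod_cast (Finset.card_insert_le _ _).trans (Nat.succ_le_succ Finset.card_image_le)
    linarith
  · rintro a (rfl | ⟨t, rfl⟩)
    · exact ⟨0, Finset.mem_insert_self _ _, by simpa using hε.le⟩
    · obtain ⟨s, hs, hst, hd⟩ := hnet t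
      rcases hst.eq_or_lt with rfl | hlt
      · exact ⟨v s, Finset.mem_insert_of_mem (Finset.mem_image_of_mem v hs), by simpa using hε.le⟩
      · rw [treeDist, if_pos hst] at hd
        rcases exists_norm_sub_le_dOrd htree hq hα hσ hmono hv hlt with h' | h'
        · exact ⟨v s, Finset.mem_insert_of_mem (Finset.mem_image_of_mem v hs), h'.trans hd.le⟩
        · exact ⟨0, Finset.mem_insert_self _ _, h'.trans hd.le⟩

end Tree

section NetSequences
variable {X : Type*} [NormedAddCommGroup X] {A : Set X} {D : ℝ}

lemma exists_isNetSeq (h0 : (0 : X) ∈ A) (hD : ∀ x ∈ A, ‖x‖ ≤ D) {N ε : ℕ → ℝ}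
    (hN : ∀ k, 1 ≤ N k) (hε : ∀ k, 0 < ε k)
    (hnet : ∀ᶠ k in Filter.atTop, ∃ F : Finset X, (F : Set X) ⊆ A ∧ (F.card : ℝ) ≤ N k ∧
      ∀ x ∈ A, ∃ y ∈ F, ‖x - y‖ ≤ ε k) :
    ∃ R > 0, ∃ S, IsNetSeq A S N (fun k => R * ε k) := by
  classical
  obtain ⟨m, hm⟩ := Filter.eventually_atTop.1 hnet
  choose! F hFA hFN hF using hm
  have hD0 : 0 ≤ D := (norm_nonneg _).trans (hD 0 h0)
  have hterm : ∀ k, 0 ≤ D / ε k := fun k => div_nonneg hD0 (hε k).le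
  have hsum : 0 ≤ ∑ k ∈ Finset.range (m + 1), D / ε k := Finset.sum_nonneg fun k _ => hterm k
  refine ⟨1 + ∑ k ∈ Finset.range (m + 1), D / ε k, by positivity,
    fun k => if m + 1 ≤ k then F k else {0}, ⟨by simp, fun k => ?_, fun k => ?_, fun k x hx => ?_⟩⟩
  · split_ifs with h
    · exact hFA k (by lia)
    · simpa using h0
  · split_ifs with h
    · exact hFN k (by lia)
    · simpa using hN k
  · split_ifs with h
    · obtain ⟨y, hy, hxy⟩ := hF k (by lia) x hx
      exact ⟨y, hy, hxy.trans (le_mul_of_one_le_left (hε k).le (by linarith))⟩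
    · refine ⟨0, by simp, ?_⟩
      have hk := Finset.single_le_sum (f := fun k => D / ε k) (fun k _ => hterm k)
        (Finset.mem_range.2 (not_le.1 h))
      rw [sub_zero, ← div_le_iff₀ (hε k)]
      exact (div_le_div_of_nonneg_right (hD x hx) (hε k).le).trans (by linarith)

variable {a b c ε₀ : ℝ}

lemma exists_isNetSeq_of_poly (h0 : (0 : X) ∈ A) (hD : ∀ x ∈ A, ‖x‖ ≤ D) (ha : 0 < a) (hb : 0 ≤ b)
    (hc : 0 < c) (hε₀ : 0 < ε₀)
    (hnet : ∀ ε, 0 < ε → ε < ε₀ → ∃ F : Finset X, (F : Set X) ⊆ A ∧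
      (F.card : ℝ) ≤ c * ε ^ (-a) * |Real.log ε| ^ b + 2 ∧ ∀ x ∈ A, ∃ y ∈ F, ‖x - y‖ ≤ ε) :
    ∃ B ≥ 1, ∃ R > 0, ∃ S, IsNetSeq A S (fun k => B * 2 ^ k)
      (fun k => R * (2 ^ (-(1 / a) * (k : ℝ)) * ((k : ℝ) + 1) ^ (b / a))) := by
  have hB : 0 ≤ c * (1 / a + b / a) ^ b := by positivity
  refine ⟨c * (1 / a + b / a) ^ b + 2, by linarith, exists_isNetSeq h0 hD (fun k => ?_)
    (fun k => by positivity) ?_⟩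
  · exact one_le_mul_of_one_le_of_one_le (by linarith) (one_le_pow₀ (by norm_num))
  have hlim : Filter.Tendsto (fun k : ℕ => (2 : ℝ) ^ (-(1 / a) * (k : ℝ)) * ((k : ℝ) + 1) ^ (b / a))
      Filter.atTop (nhds 0) := by
    have h := (summable_rpow_mul_geometric (β := b / a) (r := 2 ^ (-(1 / a))) (by positivity)
      (Real.rpow_lt_one_of_one_lt_of_neg (by norm_num)
        (neg_lt_zero.2 (by positivity)))).tendsto_atTop_zero
    refine h.congr fun k => ?_
    rw [mul_comm, Real.rpow_mul (by norm_num), Real.rpow_natCast]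
  filter_upwards [hlim.eventually (gt_mem_nhds hε₀)] with k hk
  set ε : ℝ := 2 ^ (-(1 / a) * (k : ℝ)) * ((k : ℝ) + 1) ^ (b / a) with hεdef
  have hε : 0 < ε := by positivity
  obtain ⟨F, hFA, hFc, hF⟩ := hnet ε hε hk
  refine ⟨F, hFA, hFc.trans ?_, hF⟩
  have hk1 : (0 : ℝ) < (k : ℝ) + 1 := by positivity
  have e1 : ε ^ (-a) = 2 ^ k * ((k : ℝ) + 1) ^ (-b) := by
    rw [hεdef, Real.mul_rpow (by positivity) (by positivity), ← Real.rpow_mul (by norm_num),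
      ← Real.rpow_mul hk1.le]
    congr 1
    · rw [← Real.rpow_natCast]; congr 1; field_simp
    · congr 1; field_simp
  have e2 : |Real.log ε| ≤ (1 / a + b / a) * ((k : ℝ) + 1) := by
    rw [hεdef, Real.log_mul (by positivity) (by positivity), Real.log_rpow (by norm_num),
      Real.log_rpow hk1]
    have l1 : 0 ≤ Real.log ((k : ℝ) + 1) := Real.log_nonneg (by simp)
    have l2 : Real.log ((k : ℝ) + 1) ≤ (k : ℝ) + 1 := (Real.log_le_sub_one_of_pos hk1).trans (by simp)
    have l3 : 0 ≤ Real.log 2 := Real.log_nonneg (by norm_num)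
    have l4 : Real.log 2 ≤ 1 := (Real.log_le_sub_one_of_pos (by norm_num)).trans (by norm_num)
    have hk0 : (0 : ℝ) ≤ k := k.cast_nonneg
    have h1 : |-(1 / a) * (k : ℝ) * Real.log 2| ≤ 1 / a * ((k : ℝ) + 1) := by
      have e : |-(1 / a) * (k : ℝ) * Real.log 2| = 1 / a * (k * Real.log 2) := by
        rw [neg_mul, neg_mul, abs_neg, abs_of_nonneg (by positivity), mul_assoc]
      rw [e]
      gcongr
      nlinarith
    have h2 : |b / a * Real.log ((k : ℝ) + 1)| ≤ b / a * ((k : ℝ) + 1) := by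
      rw [abs_of_nonneg (by positivity)]
      gcongr
    rw [add_mul]
    exact (abs_add_le _ _).trans (add_le_add h1 h2)
  have e3 : |Real.log ε| ^ b ≤ (1 / a + b / a) ^ b * ((k : ℝ) + 1) ^ b := by
    rw [← Real.mul_rpow (by positivity) hk1.le]
    exact Real.rpow_le_rpow (abs_nonneg _) e2 hb
  have h2k : (1 : ℝ) ≤ 2 ^ k := one_le_pow₀ (by norm_num)
  calc c * ε ^ (-a) * |Real.log ε| ^ b + 2
      ≤ c * (2 ^ k * ((k : ℝ) + 1) ^ (-b)) * ((1 / a + b / a) ^ b * ((k : ℝ) + 1) ^ b) + 2 * 2 ^ k := by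
        rw [e1]
        gcongr
        linarith
    _ = (c * (1 / a + b / a) ^ b + 2) * 2 ^ k := by
        rw [Real.rpow_neg hk1.le]
        have : ((k : ℝ) + 1) ^ b ≠ 0 := by positivity
        field_simp

lemma exists_isNetSeq_of_exp (h0 : (0 : X) ∈ A) (hD : ∀ x ∈ A, ‖x‖ ≤ D) (ha : 0 < a)
    (hc : 0 < c) (hε₀ : 0 < ε₀)
    (hnet : ∀ ε, 0 < ε → ε < ε₀ → ∃ F : Finset X, (F : Set X) ⊆ A ∧
      (F.card : ℝ) ≤ Real.exp (c * ε ^ (-a)) + 2 ∧ ∀ x ∈ A, ∃ y ∈ F, ‖x - y‖ ≤ ε) :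
    ∃ B ≥ 1, ∃ R > 0, ∃ S, IsNetSeq A S (fun k => Real.exp (B * 2 ^ k))
      (fun k => R * 2 ^ (-(1 / a) * (k : ℝ))) := by
  refine ⟨c + 2, by linarith, exists_isNetSeq h0 hD (fun k => Real.one_le_exp (by positivity))
    (fun k => by positivity) ?_⟩
  have hlim := (summable_two_rpow (t := 1 / a) (by positivity)).tendsto_atTop_zero
  filter_upwards [hlim.eventually (gt_mem_nhds hε₀)] with k hk
  obtain ⟨F, hFA, hFc, hF⟩ := hnet _ (by positivity) hk
  refine ⟨F, hFA, hFc.trans ?_, hF⟩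
  have e1 : ((2 : ℝ) ^ (-(1 / a) * (k : ℝ))) ^ (-a) = 2 ^ k := by
    rw [← Real.rpow_mul (by norm_num), ← Real.rpow_natCast]; congr 1; field_simp
  have h2k : (1 : ℝ) ≤ 2 ^ k := one_le_pow₀ (by norm_num)
  have h1 : (1 : ℝ) ≤ Real.exp (c * 2 ^ k) := Real.one_le_exp (by positivity)
  have h3 : (3 : ℝ) ≤ Real.exp (2 * 2 ^ k) := by
    linarith [Real.add_one_le_exp (2 * (2 : ℝ) ^ k)]
  rw [e1, add_mul, Real.exp_add]
  nlinarith

end NetSequences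

section Conversion
variable {e : ℕ → ℝ} {C L : ℝ}

lemma half_le_log_two : 1 / 2 ≤ Real.log 2 := by linarith [Real.log_two_gt_d9]

lemma mul_div_le_mul_log_two (hL : 0 < L) {n : ℕ} (hn : 2 ≤ n) :
    L * ((n : ℝ) / (4 * L)) ≤ ((n - 1 : ℕ) : ℝ) * Real.log 2 := by
  have h2 : (2 : ℝ) ≤ n := by exact_mod_cast hn
  rw [Nat.cast_sub (by lia), Nat.cast_one]
  have : L * ((n : ℝ) / (4 * L)) = n / 4 := by field_simp
  rw [this]
  nlinarith [half_le_log_two]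

lemma exists_rate_of_dyadic {t β : ℝ} (ht : 0 < t) (hβ : 0 ≤ β) (hC : 0 < C) (hL : 0 < L)
    (h : ∀ m n : ℕ, L * 2 ^ m ≤ ((n - 1 : ℕ) : ℝ) * Real.log 2 →
      e n ≤ C * (2 ^ (-t * (m : ℝ)) * ((m : ℝ) + 1) ^ β)) :
    ∃ C > 0, ∃ n₀, ∀ n ≥ n₀, 2 ≤ n → e n ≤ C * ((n : ℝ) ^ (-t) * Real.log n ^ β) := by
  obtain ⟨n₀, hn₀⟩ := exists_nat_ge (4 * L)
  set D := 4 + 4 * |Real.log (4 * L)| with hD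
  have hD0 : 0 < D := by positivity
  refine ⟨C * ((8 * L) ^ t * D ^ β), by positivity, n₀, fun n hn hn2 => ?_⟩
  have hn0 : (0 : ℝ) < n := by positivity
  have hlog : 1 / 2 ≤ Real.log n :=
    half_le_log_two.trans (Real.log_le_log (by norm_num) (by exact_mod_cast hn2))
  have hnL : 4 * L ≤ (n : ℝ) := hn₀.trans (by exact_mod_cast hn)
  obtain ⟨m, hm1, hm2⟩ := exists_nat_pow_near ((one_le_div (by positivity)).2 hnL)
    (by norm_num : (1 : ℝ) < 2)
  have h1 := h m n ((mul_le_mul_of_nonneg_left hm1 hL.le).trans (mul_div_le_mul_log_two hL hn2))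
  have h2 : (2 : ℝ) ^ (-t * (m : ℝ)) ≤ (8 * L) ^ t * (n : ℝ) ^ (-t) := by
    have e1 : (2 : ℝ) ^ (-t * (m : ℝ)) = ((2 : ℝ) ^ m) ^ (-t) := by
      rw [mul_comm, Real.rpow_mul (by norm_num), Real.rpow_natCast]
    have e2 : (n : ℝ) / (8 * L) ≤ 2 ^ m := by
      rw [pow_succ, div_lt_iff₀ (by positivity)] at hm2
      rw [div_le_iff₀ (by positivity)]
      linarith
    rw [e1]
    refine (Real.rpow_le_rpow_of_nonpos (by positivity) e2 (by linarith)).trans_eq ?_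
    rw [Real.div_rpow hn0.le (by positivity), Real.rpow_neg (x := 8 * L) (by positivity), div_inv_eq_mul,
      mul_comm]
  have h3 : (m : ℝ) + 1 ≤ D * Real.log n := by
    have e1 := Real.log_le_log (by positivity) hm1
    rw [Real.log_pow, Real.log_div hn0.ne' (by positivity)] at e1
    have e2 := neg_abs_le (Real.log (4 * L))
    have e3 := abs_nonneg (Real.log (4 * L))
    have e4 : (m : ℝ) / 2 ≤ m * Real.log 2 := by
      nlinarith [half_le_log_two, m.cast_nonneg (α := ℝ)]
    nlinarith
  have h4 : ((m : ℝ) + 1) ^ β ≤ D ^ β * Real.log n ^ β := by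
    rw [← Real.mul_rpow hD0.le (by linarith)]
    exact Real.rpow_le_rpow (by positivity) h3 hβ
  calc e n ≤ C * (2 ^ (-t * (m : ℝ)) * ((m : ℝ) + 1) ^ β) := h1
    _ ≤ C * (((8 * L) ^ t * (n : ℝ) ^ (-t)) * (D ^ β * Real.log n ^ β)) := by gcongr
    _ = C * ((8 * L) ^ t * D ^ β) * ((n : ℝ) ^ (-t) * Real.log n ^ β) := by ring

lemma exists_rate_of_log {s w B : ℝ} (hw : 0 < w) (hB : 1 ≤ B) (hC : 0 < C) (hL : 0 < L)
    (h : ∀ (y : ℝ) (k n : ℕ), 1 ≤ y → Real.exp (B * 2 ^ k) ≤ √y →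
      L * y ≤ ((n - 1 : ℕ) : ℝ) * Real.log 2 → e n ≤ C * (y ^ (-s) * 2 ^ (-w * (k : ℝ)))) :
    ∃ C > 0, ∃ n₀, ∀ n ≥ n₀, 2 ≤ n → e n ≤ C * ((n : ℝ) ^ (-s) * Real.log n ^ (-w)) := by
  obtain ⟨n₀, hn₀⟩ := exists_nat_ge (max ((4 * L) ^ 2) (4 * L * Real.exp (2 * B)))
  refine ⟨C * ((4 * L) ^ s * (8 * B) ^ w), by positivity, n₀, fun n hn hn2 => ?_⟩
  have hn0 : (0 : ℝ) < n := by positivity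
  have hlog : 1 / 2 ≤ Real.log n :=
    half_le_log_two.trans (Real.log_le_log (by norm_num) (by exact_mod_cast hn2))
  have hnn : (n₀ : ℝ) ≤ n := by exact_mod_cast hn
  have hn1 : (4 * L) ^ 2 ≤ (n : ℝ) := ((le_max_left _ _).trans hn₀).trans hnn
  have hn3 : 4 * L * Real.exp (2 * B) ≤ (n : ℝ) := ((le_max_right _ _).trans hn₀).trans hnn
  set y : ℝ := (n : ℝ) / (4 * L) with hy
  have hy0 : 0 < y := by positivity
  have hye : Real.exp (2 * B) ≤ y := by
    rw [hy, le_div_iff₀ (by positivity)]; linarith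
  have hy1 : 1 ≤ y := (Real.one_le_exp (by linarith)).trans hye
  have hly : 2 * B ≤ Real.log y := (Real.le_log_iff_exp_le hy0).2 hye
  have hly2 : Real.log n / 2 ≤ Real.log y := by
    have := Real.log_le_log (by positivity) hn1
    rw [Real.log_pow] at this
    rw [hy, Real.log_div hn0.ne' (by positivity)]
    push_cast at this
    linarith
  obtain ⟨k, hk1, hk2⟩ := exists_nat_pow_near ((one_le_div (by positivity)).2 hly)
    (by norm_num : (1 : ℝ) < 2)
  have h1 := h y k n hy1 (by
    rw [← Real.exp_log hy0, ← Real.exp_half, Real.exp_le_exp]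
    rw [le_div_iff₀ (by positivity)] at hk1
    linarith) (mul_div_le_mul_log_two hL hn2)
  have h2 : (2 : ℝ) ^ (-w * (k : ℝ)) ≤ (8 * B) ^ w * Real.log n ^ (-w) := by
    have e1 : (2 : ℝ) ^ (-w * (k : ℝ)) = ((2 : ℝ) ^ k) ^ (-w) := by
      rw [mul_comm, Real.rpow_mul (by norm_num), Real.rpow_natCast]
    have e2 : Real.log n / (8 * B) ≤ 2 ^ k := by
      rw [pow_succ, div_lt_iff₀ (by positivity)] at hk2
      rw [div_le_iff₀ (by positivity)]
      linarith
    rw [e1]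
    refine (Real.rpow_le_rpow_of_nonpos (by positivity) e2 (by linarith)).trans_eq ?_
    rw [Real.div_rpow (by linarith) (by positivity), Real.rpow_neg (x := 8 * B) (by positivity),
      div_inv_eq_mul, mul_comm]
  have h3 : y ^ (-s) = (4 * L) ^ s * (n : ℝ) ^ (-s) := by
    rw [hy, Real.div_rpow hn0.le (by positivity), Real.rpow_neg (x := 4 * L) (by positivity),
      div_inv_eq_mul, mul_comm]
  calc e n ≤ C * (y ^ (-s) * 2 ^ (-w * (k : ℝ))) := h1
    _ ≤ C * (((4 * L) ^ s * (n : ℝ) ^ (-s)) * ((8 * B) ^ w * Real.log n ^ (-w))) := by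
        rw [h3]; gcongr
    _ = C * ((4 * L) ^ s * (8 * B) ^ w) * ((n : ℝ) ^ (-s) * Real.log n ^ (-w)) := by ring

end Conversion

open Classical in
theorem stmt4 {T : Type} [Countable T] [PartialOrder T] [OrderBot T]
    (htree : IsTree T) (q : ℝ) (hq : 1 < q)
    (α σ : T → ℝ) (hα : ∀ t, 0 < α t) (hσpos : ∀ t, 0 < σ t)
    (hσmono : ∀ ⦃t s : T⦄, t ≤ s → σ s ≤ σ t)
    (K : ℝ) (hK : ∀ s : T, (∑ᶠ r ∈ Set.Iic s, α r ^ q) ^ (1 / q) * σ s ≤ K)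
    (glb : T → T → T) (hglb : IsGCA glb)
    [DecidableEq T]
    (hroot : σ (⊥ : T) = 1)
    (hdyad : ∀ t : T, ∃ m : ℕ, σ t = (2 : ℝ) ^ (-(m : ℤ)))
    [Fact (1 ≤ ENNReal.ofReal q)]
    (W : ellOne T →L[ℝ] ellQ T q)
    (hW : ∀ t r : T, (W (lp.single 1 t 1) : ∀ _ : T, ℝ) r =
      if r ≤ t ∧ σ r = σ t then σ t * α r else 0)
    (p p' : ℝ) (hp : p = min 2 q) (hp' : 1 / p' = 1 - 1 / p) :
    (∀ a b c : ℝ, 0 < a → 0 ≤ b → 0 < c →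
      (∃ ε₀ > 0, ∀ ε : ℝ, 0 < ε → ε < ε₀ →
        orderCoveringNumber (treeDist q α σ glb) ε ≤
          ENNReal.ofReal (c * ε ^ (-a) * |Real.log ε| ^ b)) →
      ∃ c' > 0, ∀ n : ℕ, 2 ≤ n →
        entropyNumber n W ≤ c' * (n : ℝ) ^ (-(1 / a) - 1 / p') * Real.log n ^ (b / a)) ∧
    (∀ a c : ℝ, 0 < a → 0 < c → a < p' →
      (∃ ε₀ > 0, ∀ ε : ℝ, 0 < ε → ε < ε₀ →
        orderCoveringNumber (treeDist q α σ glb) ε ≤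
          ENNReal.ofReal (Real.exp (c * ε ^ (-a)))) →
      ∃ c' > 0, ∀ n : ℕ, 2 ≤ n →
        entropyNumber n W ≤ c' * (n : ℝ) ^ (-(1 / p')) * Real.log n ^ (1 / p' - 1 / a)) ∧
    (∀ a c : ℝ, 0 < a → 0 < c → p' < a →
      (∃ ε₀ > 0, ∀ ε : ℝ, 0 < ε → ε < ε₀ →
        orderCoveringNumber (treeDist q α σ glb) ε ≤
          ENNReal.ofReal (Real.exp (c * ε ^ (-a)))) →
      ∃ c' > 0, ∀ n : ℕ, 2 ≤ n →
        entropyNumber n W ≤ c' * (n : ℝ) ^ (-(1 / a))) := by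
  have hq0 : 0 < q := by linarith
  obtain ⟨C, hC, hX⟩ : ∃ C > 0, HullEntropy (ellQ T q) (1 - 1 / p) C := by
    rcases le_total q 2 with h | h
    · rw [hp, min_eq_right h]
      exact ⟨_, by norm_num, (twoPointSmooth_lp_of_le_two hq0 h).hullEntropy hq.le (by norm_num)⟩
    · rw [hp, min_eq_left h]
      exact ⟨_, by positivity, (twoPointSmooth_lp_of_two_le h).hullEntropy (by norm_num)
        (by linarith [Real.one_le_exp hq0.le])⟩
  rw [← hp'] at hX
  have hp1 : 1 < p := hp ▸ lt_min (by norm_num) hq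
  have hs0 : 0 < 1 / p' := by
    rw [hp', sub_pos, one_div]
    exact inv_lt_one_of_one_lt₀ hp1
  have hs1 : 1 / p' ≤ 1 := by
    have : 0 < 1 / p := by positivity
    linarith
  have hp'0 : 0 < p' := one_div_pos.1 hs0
  set v : T → ellQ T q := fun t => W (lp.single 1 t 1) with hv
  set A : Set (ellQ T q) := insert 0 (Set.range v) with hA
  have h0 : (0 : ellQ T q) ∈ A := Set.mem_insert _ _
  have hvA : ∀ t, W (lp.single 1 t 1) ∈ A := fun t => Set.mem_insert_of_mem _ ⟨t, rfl⟩
  have hD : ∀ x ∈ A, ‖x‖ ≤ ‖W‖ := by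
    rintro x (rfl | ⟨t, rfl⟩)
    · simp
    · refine (W.le_opNorm _).trans_eq ?_
      rw [lp.norm_single one_pos, norm_one, mul_one]
  have hent : ∀ {r L : ℝ} {n : ℕ}, HasCover (absConvexHull ℝ A) r L →
      L ≤ ((n - 1 : ℕ) : ℝ) * Real.log 2 → entropyNumber n W ≤ r := fun h hL =>
    entropyNumber_le_of_hasCover W h0 hvA h hL
  have hlog : ∀ n : ℕ, 2 ≤ n → 0 < Real.log n := fun n hn =>
    Real.log_pos (by exact_mod_cast hn)
  have hnet : ∀ {ε M : ℝ}, 0 < ε → 0 ≤ M →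
      orderCoveringNumber (treeDist q α σ glb) ε ≤ ENNReal.ofReal M →
      ∃ F : Finset (ellQ T q), (F : Set (ellQ T q)) ⊆ A ∧ (F.card : ℝ) ≤ M + 2 ∧
        ∀ x ∈ A, ∃ y ∈ F, ‖x - y‖ ≤ ε := fun hε hM h =>
    exists_net_of_orderCoveringNumber_le htree hq0 hα hσpos hσmono hW glb hε hM h
  refine ⟨fun a b c ha hb hc ⟨ε₀, hε₀, hN⟩ => ?_, fun a c ha hc hap ⟨ε₀, hε₀, hN⟩ => ?_,
    fun a c ha hc hap ⟨ε₀, hε₀, hN⟩ => ?_⟩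
  · obtain ⟨B, hB, R, hR, S, hS⟩ := exists_isNetSeq_of_poly h0 hD ha hb hc hε₀
      fun ε h1 h2 => hnet h1 (by positivity) (hN ε h1 h2)
    obtain ⟨C', hC', L, hL, hcov⟩ :=
      hS.hasCover_of_poly hB hR hC (one_div_pos.2 ha) (div_nonneg hb ha.le) hX
    have := exists_forall_two_le
      (f := fun n : ℕ => (n : ℝ) ^ (-(1 / a + 1 / p')) * Real.log n ^ (b / a))
      (fun n hn => by have := hlog n hn; positivity)
      (exists_rate_of_dyadic (by positivity) (div_nonneg hb ha.le) hC' hL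
        fun m n h => hent (hcov m) h)
    simpa only [neg_add', mul_assoc] using this
  · obtain ⟨B, hB, R, hR, S, hS⟩ := exists_isNetSeq_of_exp h0 hD ha hc hε₀
      fun ε h1 h2 => hnet h1 (by positivity) (hN ε h1 h2)
    have hlt : 1 / p' < 1 / a := one_div_lt_one_div_of_lt ha hap
    obtain ⟨C', hC', L, hL, hcov⟩ := hS.hasCover_of_exp_fast hB hR hC hs0 hlt hs1 hX
    have := exists_forall_two_le
      (f := fun n : ℕ => (n : ℝ) ^ (-(1 / p')) * Real.log n ^ (-(1 / a - 1 / p')))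
      (fun n hn => by have := hlog n hn; positivity)
      (exists_rate_of_log (sub_pos.2 hlt) hB hC' hL
        fun y k n hy hk h => hent (hcov y k hy hk) h)
    simpa only [neg_sub, mul_assoc] using this
  · obtain ⟨B, hB, R, hR, S, hS⟩ := exists_isNetSeq_of_exp h0 hD ha hc hε₀
      fun ε h1 h2 => hnet h1 (by positivity) (hN ε h1 h2)
    have hlt : 1 / a < 1 / p' := one_div_lt_one_div_of_lt hp'0 hap
    obtain ⟨C', hC', L, hL, hcov⟩ :=
      hS.hasCover_of_exp_slow hB hR hC (one_div_pos.2 ha) hlt hs1 hX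
    have := exists_forall_two_le
      (f := fun n : ℕ => (n : ℝ) ^ (-(1 / a)) * Real.log n ^ (0 : ℝ))
      (fun n hn => by have := hlog n hn; positivity)
      (exists_rate_of_dyadic (one_div_pos.2 ha) le_rfl hC' hL
        fun m n h => by simpa only [Real.rpow_zero, mul_one] using hent (hcov m) h)
    simpa only [Real.rpow_zero, mul_one] using this
end
end

section
/- Let σ take only dyadic values σ(s) = Σ_{m≥0} 2^{-m} 1_{I_m}(s) with I_m = {t : σ(t) = 2^{-m}}. For t ∈ T put K_t = {k ≥ 0 : I_k ∩ [0,t] ≠ ∅}; for k ∈ K_t the set I_k ∩ [0,t] is an order interval [λ_k(t), θ_k(t)]. Define Z on ℓ_1(T) by Z(δ_t) = Σ_{k∈K_t} 2^{k−m} δ_{θ_k(t)} for t ∈ I_m, and let W : ℓ_1(T) → ℓ_q(T) be given by W(δ_t) = 2^{-m} Σ_{r⪯t, r∈I_m} α(r) δ_r for t ∈ I_m. Then Z is a bounded operator from ℓ_1(T) to ℓ_1(T) with ‖Z‖ ≤ 2, and the weighted summation operator factorizes as V_{α,σ} = W ∘ Z. -/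
open scoped ENNReal NNReal
open MeasureTheory

noncomputable section

lemma ellOne.hasSum_norm {T : Type} (x : ellOne T) : HasSum (fun t => ‖x t‖) ‖x‖ := by
  simpa using lp.hasSum_norm (p := 1) (by simp) x

/-- A bounded family of vectors of a Banach space is the family of images of the unit vectors
under a bounded operator on `ℓ₁(T)`. -/
lemma ellOne.exists_clm_single {T E : Type} [DecidableEq T] [NormedAddCommGroup E]
    [NormedSpace ℝ E] [CompleteSpace E] (z : T → E) (C : ℝ) (hC : 0 ≤ C)
    (hz : ∀ t, ‖z t‖ ≤ C) :
    ∃ Z : ellOne T →L[ℝ] E, (∀ t, Z (lp.single 1 t 1) = z t) ∧ ‖Z‖ ≤ C := by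
  have hbound (x : ellOne T) (t : T) : ‖x t • z t‖ ≤ C * ‖x t‖ := by
    rw [norm_smul, mul_comm]
    gcongr
    exact hz t
  have hsum (x : ellOne T) : HasSum (fun t => C * ‖x t‖) (C * ‖x‖) :=
    (hasSum_norm x).mul_left C
  have hsummable (x : ellOne T) : Summable fun t => x t • z t :=
    .of_norm_bounded (hsum x).summable (hbound x)
  let L : ellOne T →ₗ[ℝ] E :=
    { toFun := fun x => ∑' t, x t • z t
      map_add' := fun x y => by
        rw [← (hsummable x).tsum_add (hsummable y)]
        simp [add_smul]
      map_smul' := fun c x => by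
        rw [RingHom.id_apply, ← (hsummable x).tsum_const_smul c]
        simp [mul_smul] }
  refine ⟨L.mkContinuous C fun x => tsum_of_norm_bounded (hsum x) (hbound x), fun t => ?_,
    L.mkContinuous_norm_le hC _⟩
  change ∑' s, (lp.single 1 t (1 : ℝ) : ellOne T) s • z s = z t
  rw [tsum_eq_single t fun s hs => by rw [lp.single_apply_ne 1 t 1 hs, zero_smul],
    lp.single_apply_self, one_smul]

/-- Bounded operators on `ℓ₁(T)` that agree on the unit vectors are equal. -/
lemma ellOne.clm_ext {T E : Type} [DecidableEq T] [NormedAddCommGroup E]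
    [NormedSpace ℝ E] {A B : ellOne T →L[ℝ] E}
    (h : ∀ t, A (lp.single 1 t 1) = B (lp.single 1 t 1)) : A = B := by
  refine lp.ext_continuousLinearMap ENNReal.one_ne_top fun t => ?_
  ext
  simpa using h t

/-- The node `r` is the last ancestor of `t` on its level set of `σ`. -/
def IsLevelEnd {T : Type} [PartialOrder T] (σ : T → ℝ) (t r : T) : Prop :=
  r ≤ t ∧ ∀ r' : T, r < r' → r' ≤ t → σ r' < σ r

section LevelEnd

variable {T : Type} [PartialOrder T] {σ : T → ℝ} {t r r' u : T}

lemma IsLevelEnd.eq_of_apply_eq (hchain : ∀ s a b : T, a ≤ s → b ≤ s → a ≤ b ∨ b ≤ a)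
    (h : IsLevelEnd σ t r) (h' : IsLevelEnd σ t r') (heq : σ r = σ r') : r = r' := by
  by_contra hne
  rcases hchain t r r' h.1 h'.1 with hle | hle
  · exact (h.2 r' (lt_of_le_of_ne hle hne) h'.1).ne' heq
  · exact (h'.2 r (lt_of_le_of_ne hle (Ne.symm hne)) h.1).ne heq

lemma exists_isLevelEnd (hfin : (Set.Iic t).Finite) (hσ : Antitone σ) (hu : u ≤ t) :
    ∃ r, IsLevelEnd σ t r ∧ u ≤ r ∧ σ u = σ r := by
  obtain ⟨r, hr⟩ := (hfin.subset (t := {r | u ≤ r ∧ r ≤ t ∧ σ u = σ r})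
    fun r hr => hr.2.1).exists_maximal ⟨u, le_rfl, hu, rfl⟩
  refine ⟨r, ⟨hr.prop.2.1, fun r' hlt hle => ?_⟩, hr.prop.1, hr.prop.2.2⟩
  refine lt_of_le_of_ne (hσ hlt.le) fun heq => ?_
  exact hr.not_prop_of_gt hlt ⟨hr.prop.1.trans hlt.le, hle, hr.prop.2.2.trans heq.symm⟩

lemma sum_div_le_two_of_dyadic (hσ : Antitone σ)
    (hdyad : ∀ t : T, ∃ m : ℕ, σ t = (2 : ℝ) ^ (-(m : ℤ))) (S : Finset T)
    (hle : ∀ r ∈ S, r ≤ t) (hinj : Set.InjOn σ S) : ∑ r ∈ S, σ t / σ r ≤ 2 := by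
  choose m hm using hdyad
  have hmono : ∀ r ∈ S, m r ≤ m t := fun r hr => by
    have := hσ (hle r hr)
    rw [hm, hm, zpow_le_zpow_iff_right₀ one_lt_two] at this
    lia
  have hterm : ∀ r ∈ S, σ t / σ r = (1 / 2 : ℝ) ^ (m t - m r) := fun r hr => by
    rw [hm, hm, ← zpow_sub₀ two_ne_zero, one_div, inv_pow, ← zpow_natCast, ← zpow_neg,
      Nat.cast_sub (hmono r hr)]
    congr 1
    ring
  have hinj' : Set.InjOn (fun r => m t - m r) S := fun r hr s hs hrs => by
    have h1 := hmono r hr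
    have h2 := hmono s hs
    refine hinj hr hs ?_
    rw [hm, hm, show m r = m s by grind]
  rw [Finset.sum_congr rfl hterm, ← Finset.sum_image (f := fun j : ℕ => (1 / 2 : ℝ) ^ j) hinj']
  exact (summable_geometric_two.sum_le_tsum _ fun j _ => by positivity).trans_eq
    tsum_geometric_two

end LevelEnd

open Classical in
theorem stmt5 {T : Type} [Countable T] [PartialOrder T] [OrderBot T]
    (htree : IsTree T) (q : ℝ) (hq : 1 < q)
    (α σ : T → ℝ) (hα : ∀ t, 0 < α t) (hσpos : ∀ t, 0 < σ t)
    (hσmono : ∀ ⦃t s : T⦄, t ≤ s → σ s ≤ σ t)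
    (K : ℝ) (hK : ∀ s : T, (∑ᶠ r ∈ Set.Iic s, α r ^ q) ^ (1 / q) * σ s ≤ K)
    (glb : T → T → T) (hglb : IsGCA glb)
    [DecidableEq T]
    (hroot : σ (⊥ : T) = 1)
    (hdyad : ∀ t : T, ∃ m : ℕ, σ t = (2 : ℝ) ^ (-(m : ℤ)))
    [Fact (1 ≤ ENNReal.ofReal q)]
    (V : ellOne T →L[ℝ] ellQ T q)
    (hV : ∀ (x : ellOne T) (t : T), (V x : ∀ _ : T, ℝ) t =
      α t * ∑' s : {s : T // t ≤ s}, σ s.1 * (x : ∀ _ : T, ℝ) s.1)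
    
    (W : ellOne T →L[ℝ] ellQ T q)
    (hW : ∀ t r : T, (W (lp.single 1 t 1) : ∀ _ : T, ℝ) r =
      if r ≤ t ∧ σ r = σ t then σ t * α r else 0) :
    ∃ Z : ellOne T →L[ℝ] ellOne T,
      (∀ t r : T, (Z (lp.single 1 t 1) : ∀ _ : T, ℝ) r =
        if r ≤ t ∧ (∀ r' : T, r < r' → r' ≤ t → σ r' < σ r) then σ t / σ r else 0) ∧
      ‖Z‖ ≤ 2 ∧ V = W.comp Z := by
  have hσ : Antitone σ := fun t s h => hσmono h
  obtain ⟨hfin, hchain, -⟩ := htree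
  let S : T → Finset T := fun t => (hfin t).toFinset.filter (IsLevelEnd σ t)
  have hS (t r : T) : r ∈ S t ↔ IsLevelEnd σ t r := by
    simpa [S] using fun h : IsLevelEnd σ t r => h.1
  let z : T → ellOne T := fun t => ∑ r ∈ S t, (σ t / σ r) • lp.single 1 r (1 : ℝ)
  have hz (t : T) : ‖z t‖ ≤ 2 := by
    refine (norm_sum_le _ _).trans (le_trans (le_of_eq ?_) (sum_div_le_two_of_dyadic (t := t) hσ
      hdyad (S t) (fun r hr => ((hS t r).1 hr).1) fun r hr s hs h =>
        ((hS t r).1 hr).eq_of_apply_eq hchain ((hS t s).1 hs) h))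
    refine Finset.sum_congr rfl fun r _ => ?_
    rw [norm_smul, lp.norm_single one_pos, norm_one, mul_one,
      Real.norm_of_nonneg (div_pos (hσpos t) (hσpos r)).le]
  obtain ⟨Z, hZ, hZnorm⟩ := ellOne.exists_clm_single z 2 zero_le_two hz
  refine ⟨Z, fun t r => ?_, hZnorm, ellOne.clm_ext fun t => ?_⟩
  · rw [hZ, lp.coeFn_sum, Finset.sum_apply]
    simp [Pi.single_apply, hS, IsLevelEnd]
  · ext u
    have hVsingle : V (lp.single 1 t 1) u = if u ≤ t then α u * σ t else 0 := by
      rw [hV]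
      split_ifs with hut
      · rw [tsum_eq_single (⟨t, hut⟩ : {s : T // u ≤ s})]
        · simp
        · intro s hs
          have : s.1 ≠ t := fun h => hs (Subtype.ext h)
          simp [this]
      · have (s : {s : T // u ≤ s}) : s.1 ≠ t := fun h => hut (h ▸ s.2)
        simp [this]
    have hWZ : W (Z (lp.single 1 t 1)) u =
        ∑ r ∈ S t, σ t / σ r * if u ≤ r ∧ σ u = σ r then σ r * α u else 0 := by
      simp only [hZ, z, map_sum, map_smul, lp.coeFn_sum, Finset.sum_apply, lp.coeFn_smul,
        Pi.smul_apply, smul_eq_mul, hW]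
    rw [ContinuousLinearMap.comp_apply, hVsingle, hWZ]
    split_ifs with hut
    · obtain ⟨r, hr, hur, hσr⟩ := exists_isLevelEnd (hfin t) hσ hut
      rw [Finset.sum_eq_single_of_mem r ((hS t r).2 hr), if_pos ⟨hur, hσr⟩]
      · field_simp [(hσpos r).ne']
      · intro s hs hsr
        rw [if_neg, mul_zero]
        exact fun h => hsr (((hS t s).1 hs).eq_of_apply_eq hchain hr (h.2.symm.trans hσr))
    · refine (Finset.sum_eq_zero fun r hr => ?_).symm
      rw [if_neg fun h => hut (h.1.trans ((hS t r).1 hr).1), mul_zero]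
end
end
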